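/- arXiv:math/0205077 — 2 statements merged into one kernel-verified Lean document; each statement's English description precedes it below -/
import Mathlib

section
/- Let n ≥ 2 be a natural number and let g : ℂ → [0,∞) be a Borel function such that 0 < ∫_ℂ g(z)·|z|^k dm(z) < ∞ for every k ∈ ℕ (including k = 0), where m denotes Lebesgue measure on ℂ. Then Z := ∫_{ℂⁿ} ∏_{1≤i<j≤n} |z_i − z_j|² · ∏_{j=1}^n g(z_j) dm(z₁)⋯dm(z_n) lies in (0,∞); set c := 1/Z and define σ(z₁,…,z_n) = c·∏_{1≤i<j≤n} |z_i − z_j|²·∏_{j=1}^n g(z_j), and for p ∈ {1,…,n} define the marginal σ^{(p)}(u₁,…,u_p) = ∫_{ℂ^{n−p}} σ(u₁,…,u_p,z_{p+1},…,z_n) dm(z_{p+1})⋯dm(z_n) (with σ^{(n)} = σ). Then for every p ∈ {1,…,n} and all u₁,…,u_p ∈ ℂ: σ^{(p)}(u₁,…,u_p) ≤ ((n−p)!/n!)·n^p·σ^{(1)}(u₁)⋯σ^{(1)}(u_p). -/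
open MeasureTheory

/-- The (unnormalized) density `∏_{i<j} |z_i − z_j|² · ∏_j g(z_j)` on `ℂⁿ`. -/
noncomputable def vdmDensity (n : ℕ) (g : ℂ → ℝ) (z : Fin n → ℂ) : ℝ :=
  (∏ i : Fin n, ∏ j : Fin n, if i < j then ‖z i - z j‖ ^ 2 else 1) * ∏ j : Fin n, g (z j)

/-- Combine `u ∈ ℂ^p` and `w ∈ ℂ^{n−p}` into the point `(u₁,…,u_p,w₁,…,w_{n−p}) ∈ ℂⁿ`. -/
def splice {n p : ℕ} (hp : p ≤ n) (u : Fin p → ℂ) (w : Fin (n - p) → ℂ) (i : Fin n) : ℂ :=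
  if h : (i : ℕ) < p then u ⟨i, h⟩ else w ⟨(i : ℕ) - p, by omega⟩


open Matrix
open scoped ComplexOrder

/-- rectangular Vandermonde -/
def VZ (N : ℕ) {ι : Type*} (z : ι → ℂ) : Matrix ι (Fin N) ℂ := Matrix.of fun i k => z i ^ (k : ℕ)

def KM {N : ℕ} (B : Matrix (Fin N) (Fin N) ℂ) {ι : Type*} (z : ι → ℂ) : Matrix ι ι ℂ :=
  VZ N z * B * (VZ N z)ᴴ

lemma KM_psd {N : ℕ} {B : Matrix (Fin N) (Fin N) ℂ} (hB : B.PosSemidef) {ι : Type*} [Fintype ι]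
    (z : ι → ℂ) : (KM B z).PosSemidef := hB.mul_mul_conjTranspose_same _

lemma KM_sum {N : ℕ} (B : Matrix (Fin N) (Fin N) ℂ) {m : ℕ} (u : Fin m → ℂ) (r : Fin 1 → ℂ) :
    KM B (Sum.elim u r) = fromBlocks (KM B u) (VZ N u * B * (VZ N r)ᴴ) (VZ N r * B * (VZ N u)ᴴ)
      (KM B r) := by
  ext (i | i) (j | j) <;> rfl

lemma KM_append {N : ℕ} (B : Matrix (Fin N) (Fin N) ℂ) {m : ℕ} (u : Fin m → ℂ) (r : Fin 1 → ℂ) :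
    (KM B (Fin.append u r)).det = (KM B (Sum.elim u r)).det := by
  rw [← det_submatrix_equiv_self finSumFinEquiv]
  congr 1
  have : Sum.elim u r = Fin.append u r ∘ finSumFinEquiv := by
    ext (i | i) <;> simp
  rw [this]; rfl

lemma KM_det_zero {N : ℕ} {B : Matrix (Fin N) (Fin N) ℂ} (hB : B.PosSemidef) {m : ℕ}
    (u : Fin m → ℂ) (r : Fin 1 → ℂ) (h : (KM B u).det = 0) :
    (KM B (Fin.append u r)).det = 0 := by
  rw [KM_append]
  by_contra hne
  have h1 := ((KM_psd hB (Sum.elim u r)).posDef_iff_det_ne_zero).2 hne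
  have h2 := h1.submatrix (e := (Sum.inl : Fin m → Fin m ⊕ Fin 1)) Sum.inl_injective
  exact ((KM_psd hB u).posDef_iff_det_ne_zero).1 h2 h

lemma KM_det_ne {N : ℕ} (B : Matrix (Fin N) (Fin N) ℂ) {m : ℕ}
    (u : Fin m → ℂ) (r : Fin 1 → ℂ) (h : (KM B u).det ≠ 0) :
    (KM B (Fin.append u r)).det = (KM B u).det *
      (KM (B - B * (VZ N u)ᴴ * (KM B u)⁻¹ * VZ N u * B) r) 0 0 := by
  rw [KM_append, KM_sum]
  have := invertibleOfIsUnitDet _ (isUnit_iff_ne_zero.2 h)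
  rw [det_fromBlocks₁₁, det_fin_one, invOf_eq_nonsing_inv]
  congr 2
  simp only [KM, Matrix.mul_sub, Matrix.sub_mul, Matrix.mul_assoc]

lemma KM_det_re {N : ℕ} {B : Matrix (Fin N) (Fin N) ℂ} (hB : B.PosSemidef) {m : ℕ}
    (u : Fin m → ℂ) : 0 ≤ (KM B u).det.re ∧ ((KM B u).det.re : ℂ) = (KM B u).det := by
  have := Complex.nonneg_iff.1 (KM_psd hB u).det_nonneg
  exact ⟨this.1, Complex.ext (by simp) (by simpa using this.2)⟩

lemma KM_had {N : ℕ} {B : Matrix (Fin N) (Fin N) ℂ} (hB : B.PosSemidef) {m : ℕ}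
    (u : Fin m → ℂ) (r : Fin 1 → ℂ) :
    (KM B (Fin.append u r)).det.re ≤ (KM B u).det.re * (KM B r).det.re := by
  by_cases h : (KM B u).det = 0
  · rw [KM_det_zero hB u r h, h]; simp
  rw [KM_det_ne B u r h, ← (KM_det_re hB u).2, Complex.re_ofReal_mul, Complex.ofReal_re]
  refine mul_le_mul_of_nonneg_left ?_ (KM_det_re hB u).1
  rw [det_fin_one]
  have h3 : (KM (B * (VZ N u)ᴴ * (KM B u)⁻¹ * VZ N u * B) r).PosSemidef := by
    apply KM_psd
    have := ((KM_psd hB u).inv).conjTranspose_mul_mul_same (VZ N u * B)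
    rw [conjTranspose_mul, hB.1.eq] at this
    simpa only [Matrix.mul_assoc] using this
  have h4 := (Complex.nonneg_iff.1 (h3.diag_nonneg (i := 0))).1
  have h5 : KM (B - B * (VZ N u)ᴴ * (KM B u)⁻¹ * VZ N u * B) r
    = KM B r - KM (B * (VZ N u)ᴴ * (KM B u)⁻¹ * VZ N u * B) r := by
    simp only [KM, Matrix.mul_sub, Matrix.sub_mul]
  rw [h5, Matrix.sub_apply, Complex.sub_re]
  linarith

lemma KM_had_prod {N : ℕ} {B : Matrix (Fin N) (Fin N) ℂ} (hB : B.PosSemidef) {m : ℕ}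
    (u : Fin m → ℂ) :
    (KM B u).det.re ≤ ∏ i, (KM B (fun _ : Fin 1 => u i)).det.re := by
  induction m with
  | zero => simp
  | succ m ih =>
    have hu : u = Fin.append (fun i : Fin m => u i.castSucc) (fun _ : Fin 1 => u (Fin.last m)) := by
      rw [Fin.append_right_eq_snoc]
      exact (Fin.snoc_init_self u).symm
    rw [Fin.prod_univ_castSucc]
    conv_lhs => rw [hu]
    refine (KM_had hB _ _).trans ?_
    exact mul_le_mul_of_nonneg_right (ih _) (KM_det_re hB _).1

/-- Gram matrix -/
noncomputable def HM (N : ℕ) (g : ℂ → ℝ) : Matrix (Fin N) (Fin N) ℂ :=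
  Matrix.of fun k l => ∫ w : ℂ, (w ^ (l : ℕ) * star (w ^ (k : ℕ))) * (g w : ℂ)

section
variable {N : ℕ} {g : ℂ → ℝ}

lemma int_mono (hmeas : Measurable g) (hnonneg : ∀ z, 0 ≤ g z)
    (hint : ∀ k : ℕ, Integrable (fun z : ℂ => g z * ‖z‖ ^ k) ∧
      0 < ∫ z : ℂ, g z * ‖z‖ ^ k) (k l : ℕ) :
    Integrable (fun w : ℂ => (w ^ l * star (w ^ k)) * (g w : ℂ)) := by
  refine (hint (l + k)).1.mono' ?_ ?_
  · apply Measurable.aestronglyMeasurable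
    fun_prop
  · refine Filter.Eventually.of_forall fun w => ?_
    simp [abs_of_nonneg (hnonneg w), pow_add, mul_comm]

lemma KM_apply (C : Matrix (Fin N) (Fin N) ℂ) (w : ℂ) :
    KM C (fun _ : Fin 1 => w) 0 0 = ∑ l : Fin N, ∑ k : Fin N, C k l * (w ^ (k : ℕ) * star (w ^ (l : ℕ))) := by
  simp only [KM, VZ, Matrix.mul_apply, conjTranspose_apply, of_apply, Finset.sum_mul]
  refine Finset.sum_congr rfl fun l _ => Finset.sum_congr rfl fun k _ => by ring

lemma KM_int (hmeas : Measurable g) (hnonneg : ∀ z, 0 ≤ g z)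
    (hint : ∀ k : ℕ, Integrable (fun z : ℂ => g z * ‖z‖ ^ k) ∧
      0 < ∫ z : ℂ, g z * ‖z‖ ^ k) (C : Matrix (Fin N) (Fin N) ℂ) :
    Integrable (fun w : ℂ => KM C (fun _ : Fin 1 => w) 0 0 * (g w : ℂ)) ∧
    ∫ w : ℂ, KM C (fun _ : Fin 1 => w) 0 0 * (g w : ℂ) = (C * HM N g).trace := by
  have key : ∀ k l : Fin N, Integrable (fun w : ℂ => C k l * ((w ^ (k : ℕ) * star (w ^ (l : ℕ))) * (g w : ℂ))) :=
    fun k l => (int_mono hmeas hnonneg hint l k).const_mul _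
  simp only [KM_apply, Finset.sum_mul, mul_assoc] at key ⊢
  refine ⟨integrable_finsetSum _ fun l _ => integrable_finsetSum _ fun k _ => key k l, ?_⟩
  rw [integral_finsetSum _ fun l _ => integrable_finsetSum _ fun k _ => key k l]
  simp_rw [Matrix.trace, Matrix.diag, Matrix.mul_apply]
  rw [Finset.sum_comm]
  refine Finset.sum_congr rfl fun l _ => ?_
  rw [integral_finsetSum _ fun k _ => key k l]
  refine Finset.sum_congr rfl fun k _ => ?_
  rw [integral_const_mul]
  simp [HM, mul_assoc]

lemma HM_herm : (HM N g).IsHermitian := by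
  ext k l
  simp only [HM, conjTranspose_apply, of_apply]
  rw [← starRingEnd_apply, ← integral_conj]
  congr 1
  ext w
  simp [mul_comm]

lemma HM_posDef (hmeas : Measurable g) (hnonneg : ∀ z, 0 ≤ g z)
    (hint : ∀ k : ℕ, Integrable (fun z : ℂ => g z * ‖z‖ ^ k) ∧
      0 < ∫ z : ℂ, g z * ‖z‖ ^ k) : (HM N g).PosDef := by
  refine .of_dotProduct_mulVec_pos HM_herm fun x hx => ?_
  obtain ⟨hi, he⟩ := KM_int hmeas hnonneg hint (vecMulVec x (star x))
  have h1 : star x ⬝ᵥ HM N g *ᵥ x = (vecMulVec x (star x) * HM N g).trace := by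
    rw [vecMulVec_mul, trace_vecMulVec, dotProduct_mulVec, dotProduct_comm]
  let P : Polynomial ℂ := ∑ l : Fin N, Polynomial.monomial (l : ℕ) (x l)
  have hev : ∀ w, P.eval w = ∑ l : Fin N, x l * w ^ (l : ℕ) := by
    intro w
    simp [P, Polynomial.eval_finsetSum]
  have hP : P ≠ 0 := by
    intro h0
    apply hx
    ext k
    have := congrArg (fun p => Polynomial.coeff p (k : ℕ)) h0
    simpa [P, Polynomial.finsetSum_coeff, Polynomial.coeff_monomial, Fin.val_inj] using this
  have h2 : ∀ w, KM (vecMulVec x (star x)) (fun _ : Fin 1 => w) 0 0 * (g w : ℂ)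
      = ((‖P.eval w‖ ^ 2 * g w : ℝ) : ℂ) := by
    intro w
    rw [KM_apply]
    push_cast
    rw [← Complex.mul_conj', hev, map_sum, Finset.sum_mul_sum, Finset.sum_comm]
    congr 1
    refine Finset.sum_congr rfl fun l _ => Finset.sum_congr rfl fun k _ => ?_
    simp [vecMulVec_apply]
    ring
  simp_rw [h2] at hi he
  have hi' : Integrable (fun w => ‖P.eval w‖ ^ 2 * g w) := by
    exact hi.re
  rw [h1, ← he, integral_complex_ofReal, Complex.zero_lt_real]
  have hnn : ∀ w, 0 ≤ ‖P.eval w‖ ^ 2 * g w := fun w => mul_nonneg (by positivity) (hnonneg w)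
  refine lt_of_le_of_ne (integral_nonneg hnn) fun h0 => ?_
  have h3 := (integral_eq_zero_iff_of_nonneg hnn hi').1 h0.symm
  have h4 : ∀ᵐ w : ℂ, P.eval w ≠ 0 := by
    have hfin : {w : ℂ | P.eval w = 0}.Finite := by
      refine (P.roots.toFinset.finite_toSet).subset fun w hw => ?_
      simpa [hP] using hw
    have := hfin.measure_zero volume
    simpa [ae_iff] using this
  have h5 := (hint 0).2
  rw [integral_eq_zero_of_ae] at h5
  · exact lt_irrefl _ h5
  · filter_upwards [h3, h4] with w hw hw'
    simpa [hw'] using hw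

/-- the correlation function -/
noncomputable def FF (N : ℕ) (g : ℂ → ℝ) {m : ℕ} (u : Fin m → ℂ) : ℝ :=
  (KM (HM N g)⁻¹ u).det.re * ∏ j, g (u j)

lemma FF_nonneg (hmeas : Measurable g) (hnonneg : ∀ z, 0 ≤ g z)
    (hint : ∀ k : ℕ, Integrable (fun z : ℂ => g z * ‖z‖ ^ k) ∧
      0 < ∫ z : ℂ, g z * ‖z‖ ^ k) {m : ℕ} (u : Fin m → ℂ) : 0 ≤ FF N g u :=
  mul_nonneg (KM_det_re (HM_posDef hmeas hnonneg hint).inv.posSemidef u).1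
    (Finset.prod_nonneg fun _ _ => hnonneg _)

lemma FF_step (hmeas : Measurable g) (hnonneg : ∀ z, 0 ≤ g z)
    (hint : ∀ k : ℕ, Integrable (fun z : ℂ => g z * ‖z‖ ^ k) ∧
      0 < ∫ z : ℂ, g z * ‖z‖ ^ k) {m : ℕ} (u : Fin m → ℂ) :
    Integrable (fun w : ℂ => FF N g (Fin.append u (fun _ : Fin 1 => w))) ∧
    ∫ w : ℂ, FF N g (Fin.append u (fun _ : Fin 1 => w)) = ((N : ℝ) - m) * FF N g u := by
  have hH := HM_posDef (N := N) hmeas hnonneg hint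
  have hB := hH.inv.posSemidef
  set B := (HM N g)⁻¹ with hBdef
  have hdet : IsUnit (HM N g).det := isUnit_iff_ne_zero.2 hH.det_pos.ne'
  by_cases h : (KM B u).det = 0
  · have : ∀ w, FF N g (Fin.append u (fun _ : Fin 1 => w)) = 0 := fun w => by
      simp only [FF]; rw [KM_det_zero hB u _ h]; simp
    have hu : FF N g u = 0 := by
      simp only [FF]; rw [h]; simp
    simp only [this, hu]
    simp
  obtain ⟨hi, he⟩ := KM_int hmeas hnonneg hint (B - B * (VZ N u)ᴴ * (KM B u)⁻¹ * VZ N u * B)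
  have htr : ((B - B * (VZ N u)ᴴ * (KM B u)⁻¹ * VZ N u * B) * HM N g).trace = (N : ℂ) - m := by
    have e1 : B * HM N g = 1 := nonsing_inv_mul _ hdet
    rw [Matrix.sub_mul, Matrix.mul_assoc _ B, e1, Matrix.mul_one, trace_sub, Matrix.mul_assoc,
      Matrix.trace_mul_comm]
    have : (KM B u)⁻¹ * VZ N u * (B * (VZ N u)ᴴ) = 1 := by
      rw [Matrix.mul_assoc, ← Matrix.mul_assoc (VZ N u)]
      exact nonsing_inv_mul _ (isUnit_iff_ne_zero.2 h)
    rw [this]; simp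
  have hF : ∀ w, FF N g (Fin.append u (fun _ : Fin 1 => w)) = FF N g u *
      (KM (B - B * (VZ N u)ᴴ * (KM B u)⁻¹ * VZ N u * B) (fun _ : Fin 1 => w) 0 0 * (g w : ℂ)).re := by
    intro w
    simp only [FF]
    rw [← hBdef, KM_det_ne B u _ h, ← (KM_det_re hB u).2, Complex.re_ofReal_mul, Complex.ofReal_re,
      Complex.re_mul_ofReal, Fin.prod_univ_add]
    simp
    ring
  simp_rw [hF]
  have hr := hi.re
  refine ⟨hr.const_mul _, ?_⟩
  rw [integral_const_mul]
  have h6 := integral_re hi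
  rw [he, htr] at h6
  simp only [RCLike.re_eq_complex_re] at h6
  rw [h6]
  simp [mul_comm]

def spl {n p q : ℕ} (h : p + q = n) (u : Fin p → ℂ) (w : Fin q → ℂ) (i : Fin n) : ℂ :=
  if h : (i : ℕ) < p then u ⟨i, h⟩ else w ⟨(i : ℕ) - p, by omega⟩

lemma spl_meas {n p q : ℕ} (h : p + q = n) (u : Fin p → ℂ) : Measurable (spl h u) := by
  refine measurable_pi_lambda _ fun i => ?_
  unfold spl
  split_ifs <;> fun_prop

lemma FF_top (hmeas : Measurable g) (hnonneg : ∀ z, 0 ≤ g z)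
    (hint : ∀ k : ℕ, Integrable (fun z : ℂ => g z * ‖z‖ ^ k) ∧
      0 < ∫ z : ℂ, g z * ‖z‖ ^ k) (z : Fin N → ℂ) :
    vdmDensity N g z = (HM N g).det.re * FF N g z := by
  have hH := HM_posDef (N := N) hmeas hnonneg hint
  have hp := Complex.pos_iff.1 hH.det_pos
  have hre : ((HM N g).det.re : ℂ) = (HM N g).det := Complex.ext (by simp) (by simpa using hp.2)
  have h1 : (KM (HM N g)⁻¹ z).det = ((((HM N g).det.re)⁻¹ * ‖(VZ N z).det‖ ^ 2 : ℝ) : ℂ) := by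
    rw [KM, det_mul, det_mul, det_conjTranspose, det_nonsing_inv, Ring.inverse_eq_inv', ← hre]
    push_cast
    rw [← Complex.mul_conj', starRingEnd_apply]
    simp
    ring
  rw [vdmDensity, FF, h1, Complex.ofReal_re, ← mul_assoc, mul_inv_cancel_left₀ hp.1.ne']
  congr 1
  have : (VZ N z).det = ∏ i : Fin N, ∏ j ∈ Finset.Ioi i, (z j - z i) := det_vandermonde z
  rw [this]
  simp only [norm_prod, ← Finset.prod_pow]
  refine Finset.prod_congr rfl fun i _ => ?_
  rw [← Finset.prod_filter]
  refine Finset.prod_congr (by ext; simp) fun j _ => by rw [norm_sub_rev]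

lemma vdm_meas (hmeas : Measurable g) : Measurable (vdmDensity N g) := by
  unfold vdmDensity
  refine Measurable.mul (Finset.measurable_fun_prod _ fun i _ => Finset.measurable_fun_prod _ fun j _ => ?_)
    (Finset.measurable_fun_prod _ fun i _ => by fun_prop)
  split_ifs <;> fun_prop

lemma lint (hmeas : Measurable g) (hnonneg : ∀ z, 0 ≤ g z)
    (hint : ∀ k : ℕ, Integrable (fun z : ℂ => g z * ‖z‖ ^ k) ∧
      0 < ∫ z : ℂ, g z * ‖z‖ ^ k) (q : ℕ) : ∀ (m : ℕ) (h : m + q = N) (u : Fin m → ℂ),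
    ∫⁻ w : Fin q → ℂ, ENNReal.ofReal (vdmDensity N g (spl h u w)) =
      ENNReal.ofReal ((HM N g).det.re * (q.factorial * FF N g u)) := by
  induction q with
  | zero =>
    intro m h u
    have h' : m = N := h
    subst h'
    have : ∀ w, spl h u w = u := fun w => by ext i; simp [spl]
    simp [this, FF_top hmeas hnonneg hint, volume_pi]
  | succ q ih =>
    intro m h u
    have hD : 0 ≤ (HM N g).det.re :=
      (Complex.pos_iff.1 (HM_posDef (N := N) hmeas hnonneg hint).det_pos).1.le
    rw [← ((volume_preserving_piFinSuccAbove (fun _ : Fin (q+1) => ℂ) 0).symm).lintegral_comp_emb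
      (MeasurableEquiv.measurableEmbedding _)]
    rw [Measure.volume_eq_prod, lintegral_prod]
    · have hs : ∀ (a : ℂ) (b : Fin q → ℂ),
        spl h u ((MeasurableEquiv.piFinSuccAbove (fun _ : Fin (q+1) => ℂ) 0).symm (a, b)) =
          spl (by omega : (m + 1) + q = N) (Fin.append u (fun _ : Fin 1 => a)) b := by
        intro a b
        ext i
        simp only [spl, MeasurableEquiv.piFinSuccAbove_symm_apply, Fin.insertNthEquiv,
          Equiv.coe_fn_mk, Fin.insertNth_zero', Fin.append_right_eq_snoc]
        rcases lt_trichotomy (i : ℕ) m with h1 | h1 | h1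
        · simp [h1, Fin.snoc, Nat.lt_succ_of_lt h1]
        · simp [h1, Fin.snoc]
        · have e : (⟨(i : ℕ) - m, by omega⟩ : Fin (q+1)) = Fin.succ ⟨(i : ℕ) - (m+1), by omega⟩ := by
            ext; simp; omega
          rw [dif_neg (by omega), dif_neg (by omega), e, Fin.cons_succ]
      simp_rw [hs, ih]
      obtain ⟨hi, he⟩ := FF_step (N := N) hmeas hnonneg hint u
      rw [← ofReal_integral_eq_lintegral_ofReal ((hi.const_mul _).const_mul _)
        (Filter.Eventually.of_forall fun w => mul_nonneg hD (mul_nonneg (by positivity)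
          (FF_nonneg hmeas hnonneg hint _)))]
      rw [integral_const_mul, integral_const_mul, he]
      congr 2
      have : (N : ℝ) - m = q + 1 := by rw [← h]; push_cast; ring
      rw [this, Nat.factorial_succ]; push_cast; ring
    · apply Measurable.aemeasurable
      exact (ENNReal.measurable_ofReal.comp ((vdm_meas hmeas).comp (spl_meas h u))).comp
        (MeasurableEquiv.measurable _)

lemma margin (hmeas : Measurable g) (hnonneg : ∀ z, 0 ≤ g z)
    (hint : ∀ k : ℕ, Integrable (fun z : ℂ => g z * ‖z‖ ^ k) ∧
      0 < ∫ z : ℂ, g z * ‖z‖ ^ k) (q m : ℕ) (h : m + q = N) (u : Fin m → ℂ) :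
    Integrable (fun w => vdmDensity N g (spl h u w)) ∧
    ∫ w : Fin q → ℂ, vdmDensity N g (spl h u w) =
      (HM N g).det.re * (q.factorial * FF N g u) := by
  have hD : 0 ≤ (HM N g).det.re :=
    (Complex.pos_iff.1 (HM_posDef (N := N) hmeas hnonneg hint).det_pos).1.le
  have hL := lint hmeas hnonneg hint q m h u
  have hn : ∀ w, 0 ≤ vdmDensity N g (spl h u w) := fun w => by
    rw [FF_top hmeas hnonneg hint]; exact mul_nonneg hD (FF_nonneg hmeas hnonneg hint _)
  have hm : AEStronglyMeasurable (fun w => vdmDensity N g (spl h u w)) volume :=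
    ((vdm_meas hmeas).comp (spl_meas h u)).aestronglyMeasurable
  constructor
  · rw [← lintegral_ofReal_ne_top_iff_integrable hm (Filter.Eventually.of_forall hn), hL]
    exact ENNReal.ofReal_ne_top
  · rw [integral_eq_lintegral_of_nonneg_ae (Filter.Eventually.of_forall hn) hm, hL,
      ENNReal.toReal_ofReal]
    exact mul_nonneg hD (mul_nonneg (by positivity) (FF_nonneg hmeas hnonneg hint _))

end

theorem stmt2 (n : ℕ) (hn : 2 ≤ n) (g : ℂ → ℝ) (hmeas : Measurable g)
    (hnonneg : ∀ z, 0 ≤ g z)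
    (hint : ∀ k : ℕ, Integrable (fun z : ℂ => g z * ‖z‖ ^ k) ∧
      0 < ∫ z : ℂ, g z * ‖z‖ ^ k) :
    Integrable (vdmDensity n g) ∧ (0 < ∫ z : Fin n → ℂ, vdmDensity n g z) ∧
    ∀ (p : ℕ) (hp1 : 1 ≤ p) (hpn : p ≤ n) (u : Fin p → ℂ),
      (∫ w : Fin (n - p) → ℂ,
          (∫ z : Fin n → ℂ, vdmDensity n g z)⁻¹ * vdmDensity n g (splice hpn u w))
        ≤ ((n - p).factorial : ℝ) * (n : ℝ) ^ p / (n.factorial : ℝ) *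
            ∏ i : Fin p,
              ∫ w : Fin (n - 1) → ℂ,
                (∫ z : Fin n → ℂ, vdmDensity n g z)⁻¹ *
                  vdmDensity n g (splice (by omega) (fun _ : Fin 1 => u i) w) := by
  have hH := HM_posDef (N := n) hmeas hnonneg hint
  have hD : 0 < (HM n g).det.re := (Complex.pos_iff.1 hH.det_pos).1
  have h0 := margin (N := n) hmeas hnonneg hint n 0 (by omega) Fin.elim0
  have e0 : ∀ w, spl (by omega : 0 + n = n) Fin.elim0 w = w := fun w => by ext i; simp [spl]
  simp only [e0] at h0
  have hF0 : FF n g (Fin.elim0 : Fin 0 → ℂ) = 1 := by simp [FF]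
  rw [hF0] at h0
  refine ⟨h0.1, ?_, ?_⟩
  · rw [h0.2]; positivity
  intro p hp1 hpn u
  have hm : ∀ (p : ℕ) (hpn : p ≤ n) (u : Fin p → ℂ),
      ∫ w : Fin (n - p) → ℂ, vdmDensity n g (splice hpn u w) =
        (HM n g).det.re * ((n - p).factorial * FF n g u) := fun p hpn u =>
    (margin (N := n) hmeas hnonneg hint (n - p) p (by omega) u).2
  simp_rw [integral_const_mul, hm, h0.2]
  have hfac : (n.factorial : ℝ) = n * (n - 1).factorial := by
    exact_mod_cast (Nat.mul_factorial_pred (by omega)).symm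
  have h1 : ∀ x : ℝ, ((HM n g).det.re * (n.factorial * 1))⁻¹ *
      ((HM n g).det.re * ((n - 1).factorial * x)) = x / n := by
    intro x
    have : (n : ℝ) ≠ 0 := by positivity
    rw [hfac]
    field_simp
  simp_rw [h1]
  rw [Finset.prod_div_distrib]
  have hle : FF n g u ≤ ∏ i, FF n g (fun _ : Fin 1 => u i) := by
    simp only [FF, Finset.prod_mul_distrib]
    simp only [Finset.univ_unique, Finset.prod_singleton]
    exact mul_le_mul_of_nonneg_right (KM_had_prod hH.inv.posSemidef u)
      (Finset.prod_nonneg fun _ _ => hnonneg _)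
  have hn0 : (0 : ℝ) < n := by positivity
  have e1 : ((HM n g).det.re * (n.factorial * 1))⁻¹ *
      ((HM n g).det.re * ((n - p).factorial * FF n g u)) =
      ((n - p).factorial / n.factorial : ℝ) * FF n g u := by
    field_simp
  have e2 : ((n - p).factorial : ℝ) * (n : ℝ) ^ p / (n.factorial : ℝ) *
      ((∏ i, FF n g (fun _ : Fin 1 => u i)) / ∏ _i : Fin p, (n : ℝ)) =
      ((n - p).factorial / n.factorial : ℝ) * ∏ i, FF n g (fun _ : Fin 1 => u i) := by
    rw [Finset.prod_const, Finset.card_univ, Fintype.card_fin]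
    field_simp
  rw [e1, e2]
  exact mul_le_mul_of_nonneg_left hle (by positivity)
end

section
/- Fix 0 < θ < π/2. For each n ≥ 1, the integral Z_n := ∫_{ℂⁿ} ∏_{1≤i<j≤n}|d_i−d_j|²·exp(−(n/2)·Σ_{i=1}^n ((Re d_i)²/cos²θ + (Im d_i)²/sin²θ)) dm(d₁)⋯dm(d_n) lies in (0,∞), and ν_n denotes the probability measure on ℂⁿ with density Z_n^{−1}·∏_{1≤i<j≤n}|d_i−d_j|²·exp(−(n/2)·Σ_{i=1}^n ((Re d_i)²/cos²θ + (Im d_i)²/sin²θ)) with respect to Lebesgue measure on ℂⁿ. For p ∈ {1,…,n}, let ν_n^{(p)} be the marginal of ν_n on the first p coordinates. Let μ be the uniform probability distribution (normalized Lebesgue measure) on the solid ellipse {z ∈ ℂ : (Re z)²/(4cos⁴θ) + (Im z)²/(4sin⁴θ) ≤ 1}. Then for every fixed p ≥ 1: (a) ν_n^{(p)} converges weakly (i.e., ∫ f dν_n^{(p)} → ∫ f d(μ×⋯×μ) for every bounded continuous f : ℂ^p → ℝ) to the p-fold product μ × ⋯ × μ as n → ∞; and (b) ν_n^{(p)} converges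 in *-moments to μ × ⋯ × μ, i.e., for all exponents k₁,…,k_p,l₁,…,l_p ∈ ℕ, ∫_{ℂ^p} ∏_{i=1}^p z_i^{k_i}·conj(z_i)^{l_i} dν_n^{(p)} → ∫_{ℂ^p} ∏_{i=1}^p z_i^{k_i}·conj(z_i)^{l_i} d(μ×⋯×μ) as n → ∞. -/
open MeasureTheory Filter Real
open scoped ENNReal

/-- The (unnormalized) eigenvalue density
`∏_{i<j}|d_i−d_j|²·exp(−(n/2)·Σ((Re dᵢ)²/cos²θ + (Im dᵢ)²/sin²θ))` on `ℂⁿ`. -/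
noncomputable def thetaDensity (θ : ℝ) (n : ℕ) (d : Fin n → ℂ) : ℝ :=
  (∏ i : Fin n, ∏ j : Fin n, if i < j then ‖d i - d j‖ ^ 2 else 1) *
    Real.exp (-((n : ℝ) / 2) *
      ∑ i : Fin n, ((d i).re ^ 2 / Real.cos θ ^ 2 + (d i).im ^ 2 / Real.sin θ ^ 2))

/-- The probability measure `ν_n` on `ℂⁿ` with density proportional to `thetaDensity θ n`
with respect to Lebesgue measure. -/
noncomputable def nuTheta (θ : ℝ) (n : ℕ) : Measure (Fin n → ℂ) :=
  (ENNReal.ofReal (∫ d : Fin n → ℂ, thetaDensity θ n d))⁻¹ •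
    volume.withDensity fun d => ENNReal.ofReal (thetaDensity θ n d)

/-- The marginal of a measure on `ℂⁿ` on the first `p` coordinates (for `n ≥ p`; the
coordinates beyond the `n`-th are set to `0`, which is irrelevant when `p ≤ n`). -/
noncomputable def marginal (n p : ℕ) (ν : Measure (Fin n → ℂ)) : Measure (Fin p → ℂ) :=
  ν.map fun z (i : Fin p) => if h : (i : ℕ) < n then z ⟨i, h⟩ else 0

/-- The solid ellipse `{z : (Re z)²/(4cos⁴θ) + (Im z)²/(4sin⁴θ) ≤ 1}`. -/
def solidEllipse (θ : ℝ) : Set ℂ :=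
  {z : ℂ | z.re ^ 2 / (4 * Real.cos θ ^ 4) + z.im ^ 2 / (4 * Real.sin θ ^ 4) ≤ 1}

/-- The uniform probability distribution on the solid ellipse. -/
noncomputable def ellipseUniform (θ : ℝ) : Measure ℂ :=
  (volume (solidEllipse θ))⁻¹ • volume.restrict (solidEllipse θ)

section P1
open Polynomial

/-- The one-particle weight. -/
noncomputable def ww (n : ℕ) (a b : ℝ) (z : ℂ) : ℝ :=
  Real.exp (-((n : ℝ) / 2) * (z.re ^ 2 / a + z.im ^ 2 / b))

lemma ww_cont (n : ℕ) (a b : ℝ) : Continuous (ww n a b) := by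
  unfold ww; fun_prop

lemma ww_pos (n : ℕ) (a b : ℝ) (z : ℂ) : 0 < ww n a b z := Real.exp_pos _

lemma ww_le (n : ℕ) (a b : ℝ) (ha : 0 < a) (hb : 0 < b) (hab : a + b = 1) (z : ℂ) :
    ww n a b z ≤ Real.exp (-((n : ℝ) / 2) * ‖z‖ ^ 2) := by
  unfold ww
  apply Real.exp_le_exp.2
  have h1 : z.re ^ 2 ≤ z.re ^ 2 / a := by
    rw [le_div_iff₀ ha]; nlinarith [sq_nonneg z.re]
  have h2 : z.im ^ 2 ≤ z.im ^ 2 / b := by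
    rw [le_div_iff₀ hb]; nlinarith [sq_nonneg z.im]
  have h3 : ‖z‖ ^ 2 = z.re ^ 2 + z.im ^ 2 := by
    rw [Complex.sq_norm, Complex.normSq_apply]; ring
  rw [h3]
  have : (0 : ℝ) ≤ (n : ℝ) / 2 := by positivity
  nlinarith

lemma gauss_int (c : ℝ) (hc : 0 < c) : Integrable (fun z : ℂ => Real.exp (-c * ‖z‖ ^ 2)) := by
  have := (GaussianFourier.integrable_cexp_neg_mul_sq_norm_add (V := ℂ) (b := (c : ℂ))
    (by simpa using hc) 0 0).norm
  refine this.congr (ae_of_all _ fun z => ?_)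
  simp only [Complex.norm_exp]
  congr 1
  simp [← Complex.ofReal_pow]

lemma pow_ww_int (n : ℕ) (hn : 1 ≤ n) (a b : ℝ) (ha : 0 < a) (hb : 0 < b) (hab : a + b = 1)
    (k : ℕ) : Integrable (fun z : ℂ => ‖z‖ ^ k * ww n a b z) := by
  have hn' : (1 : ℝ) ≤ n := by exact_mod_cast hn
  refine Integrable.mono' (g := fun z : ℂ => ((k.factorial : ℝ) * Real.exp 1) *
    Real.exp (-(1/4 : ℝ) * ‖z‖ ^ 2)) ((gauss_int _ (by norm_num)).const_mul _)
    ((Continuous.aestronglyMeasurable (by have := ww_cont n a b; fun_prop))) ?_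
  refine ae_of_all _ fun z => ?_
  rw [Real.norm_of_nonneg (by have := (ww_pos n a b z).le; positivity)]
  have h1 : ‖z‖ ^ k ≤ k.factorial * Real.exp ‖z‖ := by
    have := Real.pow_div_factorial_le_exp ‖z‖ (norm_nonneg z) k
    rw [div_le_iff₀ (by positivity)] at this
    linarith
  have h2 : ww n a b z ≤ Real.exp (-(1/2 : ℝ) * ‖z‖ ^ 2) := by
    refine (ww_le n a b ha hb hab z).trans (Real.exp_le_exp.2 ?_)
    nlinarith [sq_nonneg ‖z‖]
  calc ‖z‖ ^ k * ww n a b z ≤ (k.factorial * Real.exp ‖z‖) * Real.exp (-(1/2 : ℝ) * ‖z‖ ^ 2) := by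
        have := (ww_pos n a b z).le
        gcongr
    _ = k.factorial * Real.exp (‖z‖ + -(1/2 : ℝ) * ‖z‖ ^ 2) := by rw [Real.exp_add]; ring
    _ ≤ k.factorial * Real.exp (1 + -(1/4 : ℝ) * ‖z‖ ^ 2) := by
        refine mul_le_mul_of_nonneg_left (Real.exp_le_exp.2 ?_) (by positivity)
        nlinarith [sq_nonneg (‖z‖ - 2)]
    _ = _ := by rw [Real.exp_add]; ring

/-- Integrand of the sesquilinear form. -/
noncomputable def qq (n : ℕ) (a b : ℝ) (f g : ℂ[X]) (z : ℂ) : ℂ :=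
  f.eval z * (starRingEnd ℂ) (g.eval z) * (ww n a b z : ℂ)

lemma qq_int (n : ℕ) (hn : 1 ≤ n) (a b : ℝ) (ha : 0 < a) (hb : 0 < b) (hab : a + b = 1)
    (f g : ℂ[X]) : Integrable (qq n a b f g) := by
  induction f using Polynomial.induction_on' with
  | add f₁ f₂ h₁ h₂ =>
    refine (h₁.add h₂).congr (ae_of_all _ fun z => ?_)
    simp [qq]; ring
  | monomial k c =>
    induction g using Polynomial.induction_on' with
    | add f₁ f₂ h₁ h₂ =>
      refine (h₁.add h₂).congr (ae_of_all _ fun z => ?_)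
      simp [qq]; ring
    | monomial l d =>
      refine Integrable.mono' ((pow_ww_int n hn a b ha hb hab (k + l)).const_mul (‖c‖ * ‖d‖)) ?_ ?_
      · have := ww_cont n a b
        refine Continuous.aestronglyMeasurable ?_
        unfold qq
        have h1 := (monomial k c).continuous
        have h2 := (monomial l d).continuous
        exact (h1.mul (Complex.continuous_conj.comp h2)).mul (Complex.continuous_ofReal.comp this)
      · refine ae_of_all _ fun z => ?_
        have := (ww_pos n a b z).le
        simp [qq, abs_of_nonneg this]
        apply le_of_eq; ring

/-- The sesquilinear form. -/
noncomputable def ip (n : ℕ) (a b : ℝ) (f g : ℂ[X]) : ℂ := ∫ z, qq n a b f g z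

section
variable {n : ℕ} (hn : 1 ≤ n) {a b : ℝ} (ha : 0 < a) (hb : 0 < b) (hab : a + b = 1)
include hn ha hb hab

lemma ip_add_left (f₁ f₂ g : ℂ[X]) : ip n a b (f₁ + f₂) g = ip n a b f₁ g + ip n a b f₂ g := by
  unfold ip
  rw [← integral_add (qq_int n hn a b ha hb hab _ _) (qq_int n hn a b ha hb hab _ _)]
  congr 1; ext z; simp [qq]; ring

lemma ip_add_right (f g₁ g₂ : ℂ[X]) : ip n a b f (g₁ + g₂) = ip n a b f g₁ + ip n a b f g₂ := by
  unfold ip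
  rw [← integral_add (qq_int n hn a b ha hb hab _ _) (qq_int n hn a b ha hb hab _ _)]
  congr 1; ext z; simp [qq]; ring

omit hn ha hb hab in
lemma ip_C_left (c : ℂ) (f g : ℂ[X]) : ip n a b (C c * f) g = c * ip n a b f g := by
  unfold ip
  rw [← integral_const_mul]
  congr 1; ext z; simp [qq]; ring

omit hn ha hb hab in
lemma ip_C_right (c : ℂ) (f g : ℂ[X]) :
    ip n a b f (C c * g) = (starRingEnd ℂ) c * ip n a b f g := by
  unfold ip
  rw [← integral_const_mul]
  congr 1; ext z; simp [qq]; ring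

omit hn ha hb hab in
lemma ip_conj (f g : ℂ[X]) : (starRingEnd ℂ) (ip n a b f g) = ip n a b g f := by
  unfold ip
  rw [← integral_conj]
  congr 1; ext z; simp only [qq, map_mul, Complex.conj_conj, Complex.conj_ofReal]; ring

omit hn ha hb hab in
lemma lin4 (q₁ q₂ q₃ q₄ : ℂ → ℂ) (h₁ : Integrable q₁) (h₂ : Integrable q₂) (h₃ : Integrable q₃)
    (h₄ : Integrable q₄) (c₁ c₂ c₃ c₄ : ℂ) :
    ∫ z, (c₁ * q₁ z + c₂ * q₂ z - (c₃ * (q₃ z + q₄ z) - c₄ * (q₃ z - q₄ z))) =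
    c₁ * (∫ z, q₁ z) + c₂ * (∫ z, q₂ z) - (c₃ * ((∫ z, q₃ z) + ∫ z, q₄ z)
      - c₄ * ((∫ z, q₃ z) - ∫ z, q₄ z)) := by
  have e1 : Integrable fun z => c₁ * q₁ z + c₂ * q₂ z := (h₁.const_mul _).add (h₂.const_mul _)
  have e2 : Integrable fun z => c₃ * (q₃ z + q₄ z) := (h₃.add h₄).const_mul _
  have e3 : Integrable fun z => c₄ * (q₃ z - q₄ z) := (h₃.sub h₄).const_mul _
  have e4 : Integrable fun z => c₃ * (q₃ z + q₄ z) - c₄ * (q₃ z - q₄ z) := e2.sub e3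
  rw [integral_sub e1 e4, integral_sub e2 e3,
    integral_add (h₁.const_mul _) (h₂.const_mul _)]
  simp only [integral_const_mul]
  rw [integral_add h₃ h₄, integral_sub h₃ h₄]

omit hn hab in
lemma qq_lineDeriv (f g : ℂ[X]) (v z : ℂ) : HasLineDerivAt ℝ (qq n a b f g) (v * qq n a b (derivative f) g z
    + (starRingEnd ℂ) v * qq n a b f (derivative g) z
    - (n * (v.re / (2 * a)) * (qq n a b (X * f) g z + qq n a b f (X * g) z)
      - Complex.I * n * (v.im / (2 * b)) * (qq n a b (X * f) g z - qq n a b f (X * g) z))) z v := by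
  unfold HasLineDerivAt
  have hl : HasDerivAt (fun t : ℝ => z + t • v) v 0 := by
    simpa using ((hasDerivAt_id (0 : ℝ)).smul_const v).const_add z
  have hpoly : ∀ f : ℂ[X], HasDerivAt (fun t : ℝ => f.eval (z + t • v))
      ((derivative f).eval z * v) 0 := by
    intro f
    have h1 : HasDerivAt (fun w => f.eval w) ((derivative f).eval (z + (0 : ℝ) • v))
      (z + (0 : ℝ) • v) := f.hasDerivAt _
    have := HasDerivAt.comp (𝕜 := ℝ) (0 : ℝ) h1 hl
    simpa [Function.comp_def] using this
  have hre : HasDerivAt (fun t : ℝ => (z + t • v).re) v.re 0 := by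
    simpa using ((hasDerivAt_id (0 : ℝ)).mul_const v.re).const_add z.re
  have him : HasDerivAt (fun t : ℝ => (z + t • v).im) v.im 0 := by
    simpa using ((hasDerivAt_id (0 : ℝ)).mul_const v.im).const_add z.im
  have hw : HasDerivAt (fun t : ℝ => ww n a b (z + t • v))
      (ww n a b z * (-((n : ℝ) / 2) * (2 * z.re * v.re / a + 2 * z.im * v.im / b))) 0 := by
    unfold ww
    have := ((((hre.pow 2).div_const a).add ((him.pow 2).div_const b)).const_mul
      (-((n : ℝ) / 2))).exp
    refine this.congr_deriv ?_
    simp [Pi.add_apply, Pi.pow_apply]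
  have hg : HasDerivAt (fun t : ℝ => (starRingEnd ℂ) (g.eval (z + t • v)))
      ((starRingEnd ℂ) ((derivative g).eval z * v)) 0 := by
    simpa using (hpoly g).star
  have := ((hpoly f).mul hg).mul hw.ofReal_comp
  refine HasDerivAt.congr_deriv (f := fun t : ℝ => qq n a b f g (z + t • v)) this ?_
  simp only [qq, Pi.mul_apply, zero_smul, add_zero]
  have ha' : (a : ℂ) ≠ 0 := by exact_mod_cast ha.ne'
  have hb' : (b : ℂ) ≠ 0 := by exact_mod_cast hb.ne'
  have hzr : (z.re : ℂ) = (z + (starRingEnd ℂ) z) / 2 := by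
    rw [Complex.add_conj]; push_cast; ring
  have hzi : (z.im : ℂ) = -Complex.I * (z - (starRingEnd ℂ) z) / 2 := by
    rw [Complex.sub_conj]; push_cast
    linear_combination ((z.im : ℂ)) * Complex.I_sq
  push_cast
  rw [hzr, hzi]
  simp only [eval_mul, eval_X, map_mul]
  field_simp
  ring_nf

lemma ip_lineDeriv (f g : ℂ[X]) (v : ℂ) :
    v * ip n a b (derivative f) g + (starRingEnd ℂ) v * ip n a b f (derivative g) =
      n * (v.re / (2 * a)) * (ip n a b (X * f) g + ip n a b f (X * g))
      - Complex.I * n * (v.im / (2 * b)) * (ip n a b (X * f) g - ip n a b f (X * g)) := by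
  have I := fun f g => qq_int n hn a b ha hb hab f g
  set D : ℂ → ℂ := fun z => v * qq n a b (derivative f) g z
    + (starRingEnd ℂ) v * qq n a b f (derivative g) z
    - (n * (v.re / (2 * a)) * (qq n a b (X * f) g z + qq n a b f (X * g) z)
      - Complex.I * n * (v.im / (2 * b)) * (qq n a b (X * f) g z - qq n a b f (X * g) z)) with hD
  have hDint : Integrable D := by
    refine Integrable.sub (((I _ _).const_mul _).add ((I _ _).const_mul _)) ?_
    exact ((((I _ _).add (I _ _)).const_mul _).sub (((I _ _).sub (I _ _)).const_mul _))
  have hderiv : ∀ z, HasLineDerivAt ℝ (qq n a b f g) (D z) z v := fun z =>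
    qq_lineDeriv ha hb f g v z
  have hz : ∫ z, D z = 0 := by
    have := integral_bilinear_hasLineDerivAt_right_eq_neg_left_of_integrable
      (μ := (volume : Measure ℂ)) (f := fun _ : ℂ => (1 : ℂ)) (f' := fun _ => 0)
      (g := qq n a b f g) (g' := D) (v := v) (B := ContinuousLinearMap.mul ℝ ℂ)
      (by simp) (by simpa using hDint) (by simpa using I f g)
      (fun x _ => by simp [HasLineDerivAt, hasDerivAt_const]) (fun x _ => hderiv x)
    simpa using this
  have hz2 : ∫ z, D z = v * ip n a b (derivative f) g
      + (starRingEnd ℂ) v * ip n a b f (derivative g)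
      - (n * (v.re / (2 * a)) * (ip n a b (X * f) g + ip n a b f (X * g))
      - Complex.I * n * (v.im / (2 * b)) * (ip n a b (X * f) g - ip n a b f (X * g))) := by
    simp only [hD, ip]
    exact lin4 _ _ _ _ (I _ _) (I _ _) (I _ _) (I _ _) _ _ _ _
  rw [hz] at hz2
  linear_combination -hz2

lemma ip_X_left (f g : ℂ[X]) :
    (n : ℂ) * ip n a b (X * f) g = ip n a b f (derivative g) +
      ((a - b : ℝ) : ℂ) * ip n a b (derivative f) g := by
  have h1 := ip_lineDeriv hn ha hb hab f g 1
  have h2 := ip_lineDeriv hn ha hb hab f g Complex.I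
  have ha' : (a : ℂ) ≠ 0 := by exact_mod_cast ha.ne'
  have hb' : (b : ℂ) ≠ 0 := by exact_mod_cast hb.ne'
  have hab' : (a : ℂ) + b = 1 := by exact_mod_cast hab
  simp at h1 h2
  have h2' : ip n a b (derivative f) g - ip n a b f (derivative g) =
    - (n * (1 / (2 * b)) * (ip n a b (X * f) g - ip n a b f (X * g))) := by
    apply mul_left_cancel₀ Complex.I_ne_zero
    rw [mul_sub]
    linear_combination h2
  field_simp at h1 h2'
  push_cast
  linear_combination (-1/2 : ℂ) * h1 + (1/2 : ℂ) * h2' + ip n a b f (derivative g) * hab'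

end
end P1

section P2
open Polynomial

/-- Rescaled monic Hermite polynomials. -/
noncomputable def hh (c : ℂ) : ℕ → ℂ[X]
  | 0 => 1
  | k + 1 => X * hh c k - C c * derivative (hh c k)

lemma hh_deriv (c : ℂ) (k : ℕ) : derivative (hh c k) = C (k : ℂ) * hh c (k - 1) := by
  induction k with
  | zero => simp [hh]
  | succ k ih =>
    have h2 : derivative (derivative (hh c k)) = C (k : ℂ) * derivative (hh c (k - 1)) := by
      rw [ih]; simp
    rw [hh]
    simp only [derivative_sub, derivative_mul, derivative_X, derivative_C, h2]
    cases k with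
    | zero => simp [hh]
    | succ m =>
      rw [ih]
      simp only [Nat.add_sub_cancel, hh]
      push_cast
      simp only [C_add, C_1]
      ring

lemma hh_X (c : ℂ) (k : ℕ) :
    X * hh c k = hh c (k + 1) + C (c * k) * hh c (k - 1) := by
  rw [hh, hh_deriv, C_mul]; ring

lemma hh_monic (c : ℂ) (k : ℕ) : (hh c k).Monic ∧ (hh c k).natDegree = k := by
  induction k with
  | zero => simp [hh]
  | succ k ih =>
    have h1 : (X * hh c k).Monic := monic_X.mul ih.1
    have h2 : (X * hh c k).natDegree = k + 1 := by
      rw [monic_X.natDegree_mul ih.1, natDegree_X, ih.2]; ring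
    have h3 : (C c * derivative (hh c k)).degree < (X * hh c k).degree := by
      rw [degree_eq_natDegree h1.ne_zero, h2]
      have hC : (C c * derivative (hh c k)).degree ≤ (derivative (hh c k)).degree := by
        rw [← smul_eq_C_mul]; exact degree_smul_le _ _
      refine lt_of_le_of_lt hC ?_
      refine lt_of_le_of_lt (degree_derivative_le) ?_
      rw [degree_eq_natDegree ih.1.ne_zero, ih.2]
      exact_mod_cast Nat.lt_succ_self k
    rw [hh]
    refine ⟨h1.sub_of_left h3, ?_⟩
    rw [natDegree_sub_eq_left_of_natDegree_lt, h2]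
    rw [h2]
    refine lt_of_le_of_lt (natDegree_C_mul_le _ _) ?_
    refine lt_of_le_of_lt (natDegree_derivative_le _) ?_
    rw [ih.2]; omega

/-- Total mass of the weight. -/
noncomputable def mass (n : ℕ) (a b : ℝ) : ℝ := ∫ z, ww n a b z

/-- Squared norm. -/
noncomputable def nrm (n : ℕ) (a b : ℝ) (k : ℕ) : ℝ := k.factorial / (n : ℝ) ^ k * mass n a b

/-- The parameter. -/
noncomputable def cc (n : ℕ) (a b : ℝ) : ℂ := (((a - b) / n : ℝ) : ℂ)

/-- The orthonormal polynomials. -/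
noncomputable def ee (n : ℕ) (a b : ℝ) (k : ℕ) : ℂ[X] :=
  C (((Real.sqrt (nrm n a b k))⁻¹ : ℝ) : ℂ) * hh (cc n a b) k

section
variable {n : ℕ} (hn : 1 ≤ n) {a b : ℝ} (ha : 0 < a) (hb : 0 < b) (hab : a + b = 1)
include hn ha hb hab

lemma mass_pos : 0 < mass n a b := by
  unfold mass
  have hi : Integrable (ww n a b) := by simpa using pow_ww_int n hn a b ha hb hab 0
  rw [integral_pos_iff_support_of_nonneg (fun z => (ww_pos n a b z).le) hi]
  have : Function.support (ww n a b) = Set.univ := by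
    ext z; simp [(ww_pos n a b z).ne']
  rw [this]; simp

lemma nrm_pos (k : ℕ) : 0 < nrm n a b k := by
  have := mass_pos hn ha hb hab
  have : (0 : ℝ) < n := by exact_mod_cast hn
  unfold nrm; positivity

omit hn ha hb hab in
lemma ip_zero_right (f : ℂ[X]) : ip n a b f 0 = 0 := by
  simp [ip, qq]

lemma ip_hh_succ (j : ℕ) (g : ℂ[X]) :
    (n : ℂ) * ip n a b (hh (cc n a b) (j + 1)) g = ip n a b (hh (cc n a b) j) (derivative g) := by
  have h := ip_X_left hn ha hb hab (hh (cc n a b) j) g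
  have h0 : (n : ℂ) ≠ 0 := by exact_mod_cast (by omega : n ≠ 0)
  rw [hh, sub_eq_add_neg, ip_add_left hn ha hb hab,
    show -(C (cc n a b) * derivative (hh (cc n a b) j)) =
      C (-cc n a b) * derivative (hh (cc n a b) j) by simp, ip_C_left, mul_add, h]
  simp only [cc]
  push_cast
  field_simp
  ring

lemma ip_hh (j k : ℕ) : ip n a b (hh (cc n a b) j) (hh (cc n a b) k) =
    if j = k then (nrm n a b j : ℂ) else 0 := by
  have h0 : (n : ℂ) ≠ 0 := by exact_mod_cast (by omega : n ≠ 0)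
  have hz : ∀ j, ip n a b (hh (cc n a b) (j + 1)) 1 = 0 := by
    intro j
    have := ip_hh_succ hn ha hb hab j 1
    rw [derivative_one, ip_zero_right] at this
    simpa [h0] using this
  induction j generalizing k with
  | zero =>
    cases k with
    | zero =>
      simp only [hh, ip, qq, nrm, mass]
      simp
      exact integral_ofReal
    | succ k =>
      rw [← ip_conj]
      simp only [hh]
      have := hz k
      simp only [hh] at this
      rw [this]; simp
  | succ j ih =>
    cases k with
    | zero => simpa [hh] using hz j
    | succ k =>
      have := ip_hh_succ hn ha hb hab j (hh (cc n a b) (k + 1))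
      rw [hh_deriv, ip_C_right, Nat.add_sub_cancel, ih k] at this
      apply mul_left_cancel₀ h0
      rw [this]
      by_cases hjk : j = k
      · subst hjk
        simp only [if_true, nrm, Nat.factorial_succ]
        push_cast
        simp
        field_simp
        ring
      · simp [hjk]

lemma ip_ee (j k : ℕ) : ip n a b (ee n a b j) (ee n a b k) = if j = k then 1 else 0 := by
  unfold ee
  rw [ip_C_left, ip_C_right, ip_hh hn ha hb hab]
  by_cases hjk : j = k
  · subst hjk
    have h := nrm_pos hn ha hb hab j
    simp only [if_true, Complex.conj_ofReal]
    norm_cast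
    have h2 := Real.mul_self_sqrt h.le
    have h3 := Real.sqrt_pos.2 h
    field_simp
    nlinarith
  · simp [hjk]

lemma nrm_succ (k : ℕ) : nrm n a b (k + 1) = (k + 1) / n * nrm n a b k := by
  have : (n : ℝ) ≠ 0 := by exact_mod_cast (by omega : n ≠ 0)
  unfold nrm
  rw [Nat.factorial_succ]; push_cast; field_simp; ring

lemma ee_X (k : ℕ) : X * ee n a b k =
    C ((Real.sqrt ((k + 1 : ℕ) / n) : ℝ) : ℂ) * ee n a b (k + 1) +
    C (((a - b) * Real.sqrt (k / n) : ℝ) : ℂ) * ee n a b (k - 1) := by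
  have hnp : (0 : ℝ) < n := by exact_mod_cast hn
  have key : ∀ k, (Real.sqrt (nrm n a b k))⁻¹ =
      Real.sqrt ((k + 1 : ℕ) / n) * (Real.sqrt (nrm n a b (k + 1)))⁻¹ := by
    intro k
    have h1 := Real.sqrt_pos.2 (nrm_pos hn ha hb hab k)
    have h2 : 0 < Real.sqrt ((k + 1 : ℕ) / n) := Real.sqrt_pos.2 (by positivity)
    rw [nrm_succ hn ha hb hab, Real.sqrt_mul (by positivity)]
    push_cast at h2 ⊢
    field_simp
  have hX := hh_X (cc n a b) k
  have e1 : X * ee n a b k = C (((Real.sqrt (nrm n a b k))⁻¹ : ℝ) : ℂ) * (X * hh (cc n a b) k) := by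
    unfold ee; ring
  rw [e1, hX]
  unfold ee
  rw [mul_add]
  congr 1
  · rw [key k, ← mul_assoc, ← C_mul]; push_cast; rfl
  · cases k with
    | zero => simp
    | succ k =>
      rw [← mul_assoc, ← mul_assoc, ← C_mul, ← C_mul]
      congr 2
      rw [Nat.add_sub_cancel, key k]
      simp only [cc]
      norm_cast
      have hs : Real.sqrt ((k + 1 : ℕ) / n) * Real.sqrt ((k + 1 : ℕ) / n) = (k + 1 : ℕ) / n :=
        Real.mul_self_sqrt (by positivity)
      have : (Real.sqrt (nrm n a b (k + 1)))⁻¹ * ((a - b) / n * (k + 1 : ℕ)) =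
        (a - b) * ((k + 1 : ℕ) / n) * (Real.sqrt (nrm n a b (k + 1)))⁻¹ := by ring
      rw [this]; linear_combination (-(a - b) * (Real.sqrt (nrm n a b (k + 1)))⁻¹) * hs

end

/-- The matrix entries of `z^k conj(z)^l` in the orthonormal basis. -/
noncomputable def gg (a b : ℝ) (n k l j m : ℕ) : ℂ :=
  ip n a b (X ^ k * ee n a b j) (X ^ l * ee n a b m)

section
variable {n : ℕ} (hn : 1 ≤ n) {a b : ℝ} (ha : 0 < a) (hb : 0 < b) (hab : a + b = 1)
include hn ha hb hab

lemma gg_zero (j m : ℕ) : gg a b n 0 0 j m = if j = m then 1 else 0 := by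
  simp only [gg, pow_zero, one_mul, ip_ee hn ha hb hab]

lemma gg_succ_left (k l j m : ℕ) : gg a b n (k + 1) l j m =
    (Real.sqrt ((j + 1 : ℕ) / n) : ℝ) * gg a b n k l (j + 1) m +
    ((a - b) * Real.sqrt (j / n) : ℝ) * gg a b n k l (j - 1) m := by
  unfold gg
  rw [pow_succ, mul_assoc, ee_X hn ha hb hab, mul_add, ip_add_left hn ha hb hab,
    mul_left_comm, mul_left_comm _ (C _), ip_C_left, ip_C_left]

lemma gg_succ_right (k l j m : ℕ) : gg a b n k (l + 1) j m =
    (Real.sqrt ((m + 1 : ℕ) / n) : ℝ) * gg a b n k l j (m + 1) +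
    ((a - b) * Real.sqrt (m / n) : ℝ) * gg a b n k l j (m - 1) := by
  unfold gg
  rw [pow_succ, mul_assoc, ee_X hn ha hb hab, mul_add, ip_add_right hn ha hb hab,
    mul_left_comm, mul_left_comm _ (C _), ip_C_right, ip_C_right, Complex.conj_ofReal,
    Complex.conj_ofReal]

end
end P2

section P3
open Polynomial

lemma theta_eq (θ : ℝ) (n : ℕ) (d : Fin n → ℂ) :
    thetaDensity θ n d = ‖(Matrix.vandermonde d).det‖ ^ 2 *
      ∏ i, ww n (Real.cos θ ^ 2) (Real.sin θ ^ 2) (d i) := by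
  unfold thetaDensity
  congr 1
  · rw [Matrix.det_vandermonde, norm_prod, ← Finset.prod_pow]
    refine Finset.prod_congr rfl fun i _ => ?_
    rw [norm_prod, ← Finset.prod_pow, ← Finset.prod_filter]
    refine Finset.prod_congr ?_ fun j _ => ?_
    · ext j; simp
    · rw [norm_sub_rev]
  · simp only [ww]
    rw [← Real.exp_sum, Finset.mul_sum]

lemma det_expand {n : ℕ} (M : Matrix (Fin n) (Fin n) ℂ) :
    M.det = ∑ σ : Equiv.Perm (Fin n), ((Equiv.Perm.sign σ : ℤ) : ℂ) * ∏ i, M i (σ i) := by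
  rw [← Matrix.det_transpose, Matrix.det_apply']
  rfl

section
variable {n : ℕ} (hn : 1 ≤ n) {a b : ℝ} (ha : 0 < a) (hb : 0 < b) (hab : a + b = 1)
include hn ha hb hab

lemma vand_eq (d : Fin n → ℂ) : (Matrix.vandermonde d).det =
    (∏ i : Fin n, ((Real.sqrt (nrm n a b i) : ℝ) : ℂ)) *
      (Matrix.of fun i j : Fin n => (ee n a b j).eval (d i)).det := by
  rw [Matrix.det_eval_matrixOfPolynomials_eq_det_vandermonde d (fun i => hh (cc n a b) i)
    (fun i => (hh_monic _ _).2) (fun i => (hh_monic _ _).1), ← Matrix.det_mul_row]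
  congr 1
  ext i j
  have := (Real.sqrt_pos.2 (nrm_pos hn ha hb hab j)).ne'
  have h2 : ((Real.sqrt (nrm n a b j) : ℝ) : ℂ) ≠ 0 := by exact_mod_cast this
  simp [ee, h2]

/-- Sum over permutations. -/
lemma dens_expand (K L : Fin n → ℕ) (d : Fin n → ℂ) :
    (∏ i, d i ^ K i * (starRingEnd ℂ) (d i) ^ L i) *
      ((‖(Matrix.vandermonde d).det‖ ^ 2 * ∏ i, ww n a b (d i) : ℝ) : ℂ) =
    (∏ i : Fin n, ((nrm n a b i : ℝ) : ℂ)) *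
      ∑ σ : Equiv.Perm (Fin n), ∑ τ : Equiv.Perm (Fin n),
        (((Equiv.Perm.sign σ : ℤ) : ℂ) * ((Equiv.Perm.sign τ : ℤ) : ℂ)) *
          ∏ i, qq n a b (X ^ K i * ee n a b (σ i)) (X ^ L i * ee n a b (τ i)) (d i) := by
  have h1 : ((‖(Matrix.vandermonde d).det‖ ^ 2 : ℝ) : ℂ) =
      (Matrix.vandermonde d).det * (starRingEnd ℂ) (Matrix.vandermonde d).det := by
    rw [Complex.mul_conj, Complex.normSq_eq_norm_sq]
  have h2 : (∏ i : Fin n, ((nrm n a b i : ℝ) : ℂ)) =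
      (∏ i : Fin n, ((Real.sqrt (nrm n a b i) : ℝ) : ℂ)) *
      (∏ i : Fin n, ((Real.sqrt (nrm n a b i) : ℝ) : ℂ)) := by
    rw [← Finset.prod_mul_distrib]
    refine Finset.prod_congr rfl fun i _ => ?_
    rw [← Complex.ofReal_mul, Real.mul_self_sqrt (nrm_pos hn ha hb hab i).le]
  rw [Complex.ofReal_mul, h1, vand_eq hn ha hb hab, det_expand, h2]
  simp only [map_mul, map_sum, map_prod, Complex.conj_ofReal, map_intCast, Matrix.of_apply]
  set S := ∏ i : Fin n, ((Real.sqrt (nrm n a b i) : ℝ) : ℂ)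
  simp only [qq, eval_mul, eval_pow, eval_X, map_mul, map_pow, Finset.prod_mul_distrib,
    Complex.ofReal_prod]
  have e : ∀ (P Q R : ℂ) (A B : Equiv.Perm (Fin n) → ℂ),
      P * Q * (S * (∑ σ, A σ) * (S * ∑ σ, B σ) * R) =
      S * S * ∑ σ, ∑ τ, P * Q * A σ * B τ * R := by
    intro P Q R A B
    simp only [← Finset.mul_sum, ← Finset.sum_mul]
    ring
  rw [e]
  congr 1
  refine Finset.sum_congr rfl fun σ _ => Finset.sum_congr rfl fun τ _ => ?_
  ring

lemma prod_qq_int (K L : Fin n → ℕ) (σ τ : Equiv.Perm (Fin n)) :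
    Integrable (fun d : Fin n → ℂ =>
      ∏ i, qq n a b (X ^ K i * ee n a b (σ i)) (X ^ L i * ee n a b (τ i)) (d i)) := by
  exact Integrable.fintype_prod (f := fun i =>
    qq n a b (X ^ K i * ee n a b (σ i)) (X ^ L i * ee n a b (τ i)))
    (fun i => qq_int n hn a b ha hb hab _ _)

lemma dens_integrable (K L : Fin n → ℕ) : Integrable (fun d : Fin n → ℂ =>
    (∏ i, d i ^ K i * (starRingEnd ℂ) (d i) ^ L i) *
      ((‖(Matrix.vandermonde d).det‖ ^ 2 * ∏ i, ww n a b (d i) : ℝ) : ℂ)) := by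
  simp only [dens_expand hn ha hb hab]
  refine Integrable.const_mul ?_ _
  refine integrable_finsetSum _ fun σ _ => integrable_finsetSum _ fun τ _ => ?_
  exact (prod_qq_int hn ha hb hab K L σ τ).const_mul _

lemma dens_integral (K L : Fin n → ℕ) : ∫ d : Fin n → ℂ,
    (∏ i, d i ^ K i * (starRingEnd ℂ) (d i) ^ L i) *
      ((‖(Matrix.vandermonde d).det‖ ^ 2 * ∏ i, ww n a b (d i) : ℝ) : ℂ) =
    (∏ i : Fin n, ((nrm n a b i : ℝ) : ℂ)) *
      ∑ σ : Equiv.Perm (Fin n),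
        (Matrix.of fun i j : Fin n => gg a b n (K i) (L i) (σ i) (σ j)).det := by
  simp only [dens_expand hn ha hb hab]
  rw [integral_const_mul, integral_finsetSum]
  swap
  · exact fun σ _ => integrable_finsetSum _ fun τ _ =>
      (prod_qq_int hn ha hb hab K L σ τ).const_mul _
  congr 1
  refine Finset.sum_congr rfl fun σ _ => ?_
  rw [integral_finsetSum _ fun τ _ => (prod_qq_int hn ha hb hab K L σ τ).const_mul _]
  rw [det_expand, ← Equiv.sum_comp (Equiv.mulLeft σ)]
  refine Finset.sum_congr rfl fun ρ _ => ?_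
  rw [integral_const_mul, integral_fintype_prod_volume_eq_prod (fun i =>
    qq n a b (X ^ K i * ee n a b (σ i)) (X ^ L i * ee n a b ((Equiv.mulLeft σ ρ) i)))]
  congr 1
  simp only [Equiv.coe_mulLeft, Equiv.Perm.sign_mul]
  rw [← Int.cast_mul, ← Units.val_mul, ← mul_assoc, Int.units_mul_self, one_mul]

end

/-- The normalisation. -/
noncomputable def NN (a b : ℝ) (n : ℕ) : ℝ := ∏ i : Fin n, nrm n a b i

lemma sc_facts {θ : ℝ} (hθ : θ ∈ Set.Ioo 0 (π / 2)) :
    0 < Real.cos θ ^ 2 ∧ 0 < Real.sin θ ^ 2 ∧ Real.cos θ ^ 2 + Real.sin θ ^ 2 = 1 := by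
  have h1 := Real.cos_pos_of_mem_Ioo (x := θ) ⟨by linarith [hθ.1, Real.pi_pos], hθ.2⟩
  have h2 := Real.sin_pos_of_pos_of_lt_pi hθ.1 (by linarith [hθ.2, Real.pi_pos])
  exact ⟨by positivity, by positivity, by rw [add_comm]; exact Real.sin_sq_add_cos_sq θ⟩

lemma theta_integrable {θ : ℝ} (hθ : θ ∈ Set.Ioo 0 (π / 2)) {n : ℕ} (hn : 1 ≤ n) :
    Integrable (thetaDensity θ n) := by
  obtain ⟨ha, hb, hab⟩ := sc_facts hθ
  have := (dens_integrable hn ha hb hab (fun _ => 0) (fun _ => 0)).re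
  refine this.congr (ae_of_all _ fun d => ?_)
  simp only [pow_zero, mul_one, Finset.prod_const_one, one_mul, theta_eq]
  exact RCLike.ofReal_re _

lemma theta_integral {θ : ℝ} (hθ : θ ∈ Set.Ioo 0 (π / 2)) {n : ℕ} (hn : 1 ≤ n) :
    ∫ d, thetaDensity θ n d = NN (Real.cos θ ^ 2) (Real.sin θ ^ 2) n * n.factorial := by
  obtain ⟨ha, hb, hab⟩ := sc_facts hθ
  have := dens_integral hn ha hb hab (fun _ => 0) (fun _ => 0)
  simp only [pow_zero, mul_one, Finset.prod_const_one, one_mul, ← theta_eq] at this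
  have h1 : ∀ σ : Equiv.Perm (Fin n), (Matrix.of fun i j : Fin n =>
      gg (Real.cos θ ^ 2) (Real.sin θ ^ 2) n 0 0 (σ i) (σ j)).det = 1 := by
    intro σ
    have : (Matrix.of fun i j : Fin n =>
      gg (Real.cos θ ^ 2) (Real.sin θ ^ 2) n 0 0 (σ i) (σ j)) = 1 := by
      ext i j
      simp [gg_zero hn ha hb hab, Matrix.one_apply, Fin.val_inj]
    rw [this, Matrix.det_one]
  simp only [h1, Finset.sum_const, Finset.card_univ, Fintype.card_perm, Fintype.card_fin] at this
  apply Complex.ofReal_injective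
  rw [← integral_complex_ofReal, this]
  simp [NN]

lemma NN_pos {a b : ℝ} (ha : 0 < a) (hb : 0 < b) (hab : a + b = 1) {n : ℕ} (hn : 1 ≤ n) :
    0 < NN a b n := Finset.prod_pos fun i _ => nrm_pos hn ha hb hab _

lemma nu_integrable {θ : ℝ} (hθ : θ ∈ Set.Ioo 0 (π / 2)) {n : ℕ} (hn : 1 ≤ n) (f : (Fin n → ℂ) → ℂ)
    (hf : Integrable (fun d => f d * (thetaDensity θ n d : ℂ))) :
    Integrable f (nuTheta θ n) := by
  have hpos : ∀ d, 0 ≤ thetaDensity θ n d := by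
    intro d; unfold thetaDensity
    refine mul_nonneg (Finset.prod_nonneg fun i _ => Finset.prod_nonneg fun j _ => ?_)
      (Real.exp_pos _).le
    split_ifs <;> positivity
  have hcont : Measurable (thetaDensity θ n) := by
    have : thetaDensity θ n = _ := funext fun d => theta_eq θ n d
    rw [this]
    refine Continuous.measurable ?_
    have hw := ww_cont n (Real.cos θ ^ 2) (Real.sin θ ^ 2)
    simp only [Matrix.det_vandermonde]
    fun_prop
  obtain ⟨ha, hb, hab⟩ := sc_facts hθ
  unfold nuTheta
  refine Integrable.smul_measure ?_ ?_
  · rw [integrable_withDensity_iff_integrable_smul' (by fun_prop) (ae_of_all _ fun _ => by simp)]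
    refine hf.congr (ae_of_all _ fun d => ?_)
    simp [ENNReal.toReal_ofReal (hpos d), mul_comm]
  · rw [theta_integral hθ hn]
    have := NN_pos ha hb hab hn
    simp only [ne_eq, ENNReal.inv_eq_top, ENNReal.ofReal_eq_zero, not_le]
    positivity

lemma nu_integral {θ : ℝ} (hθ : θ ∈ Set.Ioo 0 (π / 2)) {n : ℕ} (hn : 1 ≤ n) (f : (Fin n → ℂ) → ℂ) :
    ∫ d, f d ∂(nuTheta θ n) = ((∫ d, thetaDensity θ n d : ℝ) : ℂ)⁻¹ *
      ∫ d, f d * (thetaDensity θ n d : ℂ) := by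
  have hpos : ∀ d, 0 ≤ thetaDensity θ n d := by
    intro d; unfold thetaDensity
    refine mul_nonneg (Finset.prod_nonneg fun i _ => Finset.prod_nonneg fun j _ => ?_)
      (Real.exp_pos _).le
    split_ifs <;> positivity
  have hcont : Measurable (thetaDensity θ n) := by
    have : thetaDensity θ n = _ := funext fun d => theta_eq θ n d
    rw [this]
    refine Continuous.measurable ?_
    have hw := ww_cont n (Real.cos θ ^ 2) (Real.sin θ ^ 2)
    simp only [Matrix.det_vandermonde]
    fun_prop
  obtain ⟨ha, hb, hab⟩ := sc_facts hθ
  unfold nuTheta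
  rw [integral_smul_measure, integral_withDensity_eq_integral_toReal_smul (by fun_prop)
    (ae_of_all _ fun _ => by simp)]
  have hZ : 0 ≤ ∫ d, thetaDensity θ n d := by
    rw [theta_integral hθ hn]
    have := NN_pos ha hb hab hn
    positivity
  rw [ENNReal.toReal_inv, ENNReal.toReal_ofReal hZ, Complex.real_smul, Complex.ofReal_inv]
  congr 1
  refine integral_congr_ae (ae_of_all _ fun d => ?_)
  simp [ENNReal.toReal_ofReal (hpos d), mul_comm]

end P3

section P4

lemma perm_avg {p n : ℕ} (ι : Fin p ↪ Fin n) (D : (Fin p → Fin n) → ℂ)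
    (hD : ∀ s, ¬ Function.Injective s → D s = 0) :
    (n.descFactorial p : ℂ) * ∑ σ : Equiv.Perm (Fin n), D (fun i => σ (ι i)) =
      (n.factorial : ℂ) * ∑ s, D s := by
  classical
  set N : (Fin p → Fin n) → ℕ := fun s =>
    (Finset.univ.filter fun σ : Equiv.Perm (Fin n) => (fun i => σ (ι i)) = s).card with hN
  have hNeq : ∀ s, Function.Injective s → N s = N ι := by
    intro s hs
    have := Equiv.Perm.isMultiplyPretransitive (Fin n) p
    obtain ⟨g, hg⟩ := MulAction.exists_smul_eq (Equiv.Perm (Fin n)) ι (⟨s, hs⟩ : Fin p ↪ Fin n)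
    have hg' : ∀ i, g (ι i) = s i := fun i => by
      have := DFunLike.congr_fun hg i
      simpa using this
    symm
    refine Finset.card_bij (fun σ _ => g * σ) ?_ ?_ ?_
    · intro σ hσ
      simp only [Finset.mem_filter, Finset.mem_univ, true_and] at hσ ⊢
      funext i
      have := congrFun hσ i
      simp [this, hg']
    · intro σ _ τ _ h
      exact mul_left_cancel h
    · intro σ hσ
      simp only [Finset.mem_filter, Finset.mem_univ, true_and] at hσ
      refine ⟨g⁻¹ * σ, ?_, by simp⟩
      simp only [Finset.mem_filter, Finset.mem_univ, true_and]
      funext i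
      have := congrFun hσ i
      simp [this, ← hg']
  have hsum : ∀ D : (Fin p → Fin n) → ℂ, (∀ s, ¬ Function.Injective s → D s = 0) →
      ∑ σ : Equiv.Perm (Fin n), D (fun i => σ (ι i)) = (N ι : ℂ) * ∑ s, D s := by
    intro D hD
    rw [← Finset.sum_fiberwise (s := Finset.univ)
      (g := fun σ : Equiv.Perm (Fin n) => (fun i => σ (ι i) : Fin p → Fin n)), Finset.mul_sum]
    refine Finset.sum_congr rfl fun s _ => ?_
    have : ∀ σ ∈ Finset.univ.filter (fun σ : Equiv.Perm (Fin n) => (fun i => σ (ι i)) = s),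
        D (fun i => σ (ι i)) = D s := by
      intro σ hσ
      simp only [Finset.mem_filter, Finset.mem_univ, true_and] at hσ
      rw [hσ]
    rw [Finset.sum_congr rfl this, Finset.sum_const, nsmul_eq_mul]
    by_cases hs : Function.Injective s
    · rw [← hNeq s hs]
    · rw [hD s hs]; simp
  have hcard : (n.factorial : ℂ) = (N ι : ℂ) * n.descFactorial p := by
    have := hsum (fun s => if Function.Injective s then 1 else 0) (fun s hs => by simp [hs])
    have h1 : ∀ σ : Equiv.Perm (Fin n), Function.Injective (fun i => σ (ι i)) :=
      fun σ => σ.injective.comp ι.injective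
    simp only [h1, if_true, Finset.sum_const, Finset.card_univ, Fintype.card_perm,
      Fintype.card_fin] at this
    have h2 : (∑ s : Fin p → Fin n, if Function.Injective s then (1 : ℂ) else 0) =
        n.descFactorial p := by
      rw [Finset.sum_boole]
      have h3 := Fintype.card_embedding_eq (α := Fin p) (β := Fin n)
      simp only [Fintype.card_fin] at h3
      rw [← h3, ← Fintype.card_subtype]
      norm_cast
      exact Fintype.card_congr (Equiv.subtypeInjectiveEquivEmbedding _ _)
    rw [h2] at this
    simpa using this
  rw [hsum D hD, hcard]; ring

lemma block_det {p q : ℕ} (M : Matrix (Fin (p + q)) (Fin (p + q)) ℂ)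
    (hM : ∀ (i : Fin q) j, M (Fin.natAdd p i) j = if Fin.natAdd p i = j then 1 else 0) :
    M.det = (Matrix.of fun i j : Fin p => M (Fin.castAdd q i) (Fin.castAdd q j)).det := by
  rw [← Matrix.det_submatrix_equiv_self finSumFinEquiv M]
  have : M.submatrix finSumFinEquiv finSumFinEquiv = Matrix.fromBlocks
      (Matrix.of fun i j : Fin p => M (Fin.castAdd q i) (Fin.castAdd q j))
      (Matrix.of fun (i : Fin p) (j : Fin q) => M (Fin.castAdd q i) (Fin.natAdd p j)) 0 1 := by
    ext i j
    rcases i with i | i <;> rcases j with j | j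
    · simp
    · simp
    · simp only [Matrix.submatrix_apply, finSumFinEquiv_apply_right, finSumFinEquiv_apply_left,
        Matrix.fromBlocks_apply₂₁, Matrix.zero_apply, hM]
      rw [if_neg]
      intro h
      have := congrArg Fin.val h
      simp at this
      omega
    · simp [hM, Matrix.one_apply]
  rw [this, Matrix.det_fromBlocks_zero₂₁, Matrix.det_one, mul_one]

lemma marginal_map_meas (n p : ℕ) : Measurable (fun (z : Fin n → ℂ) (i : Fin p) =>
    if h : (i : ℕ) < n then z ⟨i, h⟩ else 0) := by
  refine measurable_pi_lambda _ fun i => ?_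
  by_cases h : (i : ℕ) < n
  · simp only [h, dif_pos]; fun_prop
  · simp only [h, dif_neg, not_false_eq_true]; fun_prop

lemma mono_cont {p : ℕ} (kk ll : Fin p → ℕ) :
    Continuous fun z : Fin p → ℂ => ∏ i, (z i) ^ kk i * (starRingEnd ℂ (z i)) ^ ll i := by
  have := Complex.continuous_conj
  fun_prop

lemma ext_prod {p q : ℕ} (kk ll : Fin p → ℕ) (d : Fin (p + q) → ℂ) :
    (∏ i : Fin p, ((fun i : Fin p => if h : (i : ℕ) < p + q then d ⟨i, h⟩ else 0) i) ^ kk i *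
      (starRingEnd ℂ ((fun i : Fin p => if h : (i : ℕ) < p + q then d ⟨i, h⟩ else 0) i)) ^ ll i)
    = ∏ i, d i ^ (Fin.append kk (fun _ : Fin q => 0)) i *
      (starRingEnd ℂ) (d i) ^ (Fin.append ll (fun _ : Fin q => 0)) i := by
  rw [Fin.prod_univ_add]
  simp only [Fin.append_left, Fin.append_right, pow_zero, mul_one, Finset.prod_const_one]
  refine Finset.prod_congr rfl fun i _ => ?_
  have h : (i : ℕ) < p + q := by omega
  simp only [h, dif_pos]
  rfl

lemma marg_integrable {θ : ℝ} (hθ : θ ∈ Set.Ioo 0 (π / 2)) {p n : ℕ} (hp : 1 ≤ p) (hpn : p ≤ n)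
    (kk ll : Fin p → ℕ) :
    Integrable (fun z : Fin p → ℂ => ∏ i, (z i) ^ kk i * (starRingEnd ℂ (z i)) ^ ll i)
      (marginal n p (nuTheta θ n)) := by
  obtain ⟨ha, hb, hab⟩ := sc_facts hθ
  obtain ⟨q, rfl⟩ := Nat.exists_eq_add_of_le hpn
  unfold marginal
  rw [integrable_map_measure (mono_cont kk ll).aestronglyMeasurable
    (marginal_map_meas _ _).aemeasurable]
  refine nu_integrable hθ (by omega) _ ?_
  simp only [Function.comp_def, ext_prod, theta_eq]
  exact dens_integrable (by omega) ha hb hab _ _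

lemma marg_integral {θ : ℝ} (hθ : θ ∈ Set.Ioo 0 (π / 2)) {p n : ℕ} (hp : 1 ≤ p) (hpn : p ≤ n)
    (kk ll : Fin p → ℕ) :
    ∫ z : Fin p → ℂ, ∏ i, (z i) ^ kk i * (starRingEnd ℂ (z i)) ^ ll i
      ∂(marginal n p (nuTheta θ n)) = (n.descFactorial p : ℂ)⁻¹ *
      ∑ s : Fin p → Fin n, (Matrix.of fun i j : Fin p =>
        gg (Real.cos θ ^ 2) (Real.sin θ ^ 2) n (kk i) (ll i) (s i) (s j)).det := by
  obtain ⟨ha, hb, hab⟩ := sc_facts hθ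
  obtain ⟨q, rfl⟩ := Nat.exists_eq_add_of_le hpn
  have hn : 1 ≤ p + q := by omega
  unfold marginal
  rw [integral_map (marginal_map_meas _ _).aemeasurable (mono_cont kk ll).aestronglyMeasurable,
    nu_integral hθ hn]
  simp only [ext_prod]
  rw [theta_integral hθ hn]
  simp only [theta_eq]
  rw [dens_integral hn ha hb hab]
  have h1 : ∀ σ : Equiv.Perm (Fin (p + q)), (Matrix.of fun i j : Fin (p + q) =>
      gg (Real.cos θ ^ 2) (Real.sin θ ^ 2) (p + q) (Fin.append kk (fun _ : Fin q => 0) i)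
      (Fin.append ll (fun _ : Fin q => 0) i) (σ i) (σ j)).det = (Matrix.of fun i j : Fin p =>
        gg (Real.cos θ ^ 2) (Real.sin θ ^ 2) (p + q) (kk i) (ll i)
          (σ (Fin.castAddEmb q i)) (σ (Fin.castAddEmb q j))).det := by
    intro σ
    rw [block_det]
    · simp
    · intro i j
      simp [gg_zero hn ha hb hab, Fin.val_inj]
  simp only [h1]
  have h2 := perm_avg (Fin.castAddEmb q : Fin p ↪ Fin (p + q)) (fun s =>
    (Matrix.of fun i j : Fin p =>
        gg (Real.cos θ ^ 2) (Real.sin θ ^ 2) (p + q) (kk i) (ll i) (s i) (s j)).det) (by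
      intro s hs
      simp only [Function.Injective, not_forall] at hs
      obtain ⟨i, j, hij, hne⟩ := hs
      exact Matrix.det_zero_of_column_eq hne (fun k => by simp [hij]))
  simp only at h2
  have h3 : ((p + q).descFactorial p : ℂ) ≠ 0 := by
    have := Nat.descFactorial_pos.2 hpn
    exact_mod_cast this.ne'
  have h4 : ((p + q).factorial : ℂ) ≠ 0 := by exact_mod_cast (Nat.factorial_pos _).ne'
  have h5 : (NN (Real.cos θ ^ 2) (Real.sin θ ^ 2) (p + q) : ℂ) ≠ 0 := by
    exact_mod_cast (NN_pos ha hb hab hn).ne'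
  have h6 : (∏ i : Fin (p + q), ((nrm (p + q) (Real.cos θ ^ 2) (Real.sin θ ^ 2) i : ℝ) : ℂ)) =
    (NN (Real.cos θ ^ 2) (Real.sin θ ^ 2) (p + q) : ℂ) := by simp [NN]
  rw [h6, Complex.ofReal_mul, Complex.ofReal_natCast]
  field_simp
  linear_combination h2

end P4

section P5
open scoped Topology

/-- Circle moments. -/
noncomputable def gcI (τ : ℝ) (k l : ℕ) (d : ℤ) (φ : ℝ) : ℂ :=
  (Complex.exp (φ * Complex.I) + τ * Complex.exp (-(φ * Complex.I))) ^ k *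
  (Complex.exp (-(φ * Complex.I)) + τ * Complex.exp (φ * Complex.I)) ^ l *
  Complex.exp (d * (φ * Complex.I))

/-- Circle moments. -/
noncomputable def gc (τ : ℝ) (k l : ℕ) (d : ℤ) : ℂ :=
  (2 * π : ℂ)⁻¹ * ∫ φ in (-π)..π, gcI τ k l d φ

lemma gcI_cont (τ : ℝ) (k l : ℕ) (d : ℤ) : Continuous (gcI τ k l d) := by
  unfold gcI; fun_prop

lemma gc_succ_left (τ : ℝ) (k l : ℕ) (d : ℤ) :
    gc τ (k + 1) l d = gc τ k l (d + 1) + τ * gc τ k l (d - 1) := by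
  unfold gc
  have : ∀ φ, gcI τ (k + 1) l d φ = gcI τ k l (d + 1) φ + τ * gcI τ k l (d - 1) φ := by
    intro φ
    simp only [gcI, pow_succ]
    push_cast
    rw [add_mul (d : ℂ), sub_mul (d : ℂ), one_mul, sub_eq_add_neg, Complex.exp_add,
      Complex.exp_add]
    ring
  simp only [this]
  rw [intervalIntegral.integral_add ((gcI_cont _ _ _ _).intervalIntegrable _ _)
    (((gcI_cont _ _ _ _).intervalIntegrable _ _).const_mul _),
    intervalIntegral.integral_const_mul]
  ring

lemma gc_succ_right (τ : ℝ) (k l : ℕ) (d : ℤ) :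
    gc τ k (l + 1) d = gc τ k l (d - 1) + τ * gc τ k l (d + 1) := by
  unfold gc
  have : ∀ φ, gcI τ k (l + 1) d φ = gcI τ k l (d - 1) φ + τ * gcI τ k l (d + 1) φ := by
    intro φ
    simp only [gcI, pow_succ]
    push_cast
    rw [add_mul (d : ℂ), sub_mul (d : ℂ), one_mul, sub_eq_add_neg, Complex.exp_add,
      Complex.exp_add]
    ring
  simp only [this]
  rw [intervalIntegral.integral_add ((gcI_cont _ _ _ _).intervalIntegrable _ _)
    (((gcI_cont _ _ _ _).intervalIntegrable _ _).const_mul _),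
    intervalIntegral.integral_const_mul]
  ring

lemma gc_zero (τ : ℝ) (d : ℤ) : gc τ 0 0 d = if d = 0 then 1 else 0 := by
  unfold gc gcI
  have hpi : (π : ℂ) ≠ 0 := by exact_mod_cast Real.pi_ne_zero
  by_cases hd : d = 0
  · subst hd
    simp
    field_simp
    ring
  · simp only [pow_zero, one_mul, hd, if_false]
    have hc : (d * Complex.I : ℂ) ≠ 0 := by simp [hd]
    have := integral_exp_mul_complex (a := -π) (b := π) hc
    have e : ∀ φ : ℝ, Complex.exp (d * (φ * Complex.I)) = Complex.exp (d * Complex.I * φ) := by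
      intro φ; ring_nf
    simp only [e, this]
    have h2 : Complex.exp (d * Complex.I * π) = Complex.exp (d * Complex.I * (-π : ℝ)) := by
      rw [Complex.exp_eq_exp_iff_exists_int]
      exact ⟨d, by push_cast; ring⟩
    rw [h2]; simp

section
variable {a b : ℝ} (ha : 0 < a) (hb : 0 < b) (hab : a + b = 1)
include ha hb hab

lemma gg_band {n : ℕ} (hn : 1 ≤ n) (k l : ℕ) : ∀ j m : ℕ, (k + l + m < j ∨ k + l + j < m) →
    gg a b n k l j m = 0 := by
  induction k with
  | zero =>
    induction l with
    | zero =>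
      intro j m h
      rw [gg_zero hn ha hb hab, if_neg (by omega)]
    | succ l ih =>
      intro j m h
      rw [gg_succ_right hn ha hb hab, ih j (m + 1) (by omega)]
      cases m with
      | zero => simp
      | succ m => rw [ih j (m + 1 - 1) (by omega)]; simp
  | succ k ih =>
    intro j m h
    rw [gg_succ_left hn ha hb hab, ih (j + 1) m (by omega)]
    cases j with
    | zero => simp
    | succ j => rw [ih (j + 1 - 1) m (by omega)]; simp

lemma gg_bound (k l : ℕ) : ∀ R : ℕ, ∃ C : ℝ, 0 ≤ C ∧ ∀ n j m : ℕ, 1 ≤ n → j ≤ R * n → m ≤ R * n →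
    ‖gg a b n k l j m‖ ≤ C := by
  have habs : |a - b| ≤ 1 := by rw [abs_le]; constructor <;> linarith
  have hs : ∀ R n j : ℕ, 1 ≤ n → j ≤ R * n → Real.sqrt (j / n) ≤ Real.sqrt R := by
    intro R n j hn hj
    have : (0 : ℝ) < n := by exact_mod_cast hn
    apply Real.sqrt_le_sqrt
    rw [div_le_iff₀ this]
    exact_mod_cast hj
  have step : ∀ (R n j : ℕ) (C : ℝ) (x y : ℂ), 0 ≤ C → 1 ≤ n → j ≤ R * n → ‖x‖ ≤ C → ‖y‖ ≤ C →
      ‖(Real.sqrt ((j + 1 : ℕ) / n) : ℝ) * x + ((a - b) * Real.sqrt (j / n) : ℝ) * y‖ ≤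
        Real.sqrt (R + 1 : ℕ) * C + Real.sqrt R * C := by
    intro R n j C x y hC hn hj hx hy
    refine (norm_add_le _ _).trans ?_
    rw [norm_mul, norm_mul, Complex.norm_real, Complex.norm_real, norm_mul,
      Real.norm_of_nonneg (Real.sqrt_nonneg _), Real.norm_of_nonneg (Real.sqrt_nonneg _),
      Real.norm_eq_abs]
    have h1 := hs (R + 1) n (j + 1) hn (by nlinarith)
    have h2 := hs R n j hn hj
    have h3 : |a - b| * Real.sqrt (j / n) ≤ Real.sqrt R := by
      calc |a - b| * Real.sqrt (j / n) ≤ 1 * Real.sqrt (j / n) := by gcongr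
        _ ≤ _ := by linarith
    gcongr
  induction k with
  | zero =>
    induction l with
    | zero =>
      intro R
      refine ⟨1, zero_le_one, fun n j m hn _ _ => ?_⟩
      rw [gg_zero hn ha hb hab]; split_ifs <;> simp
    | succ l ih =>
      intro R
      obtain ⟨C, hC, h⟩ := ih (R + 1)
      refine ⟨Real.sqrt (R + 1 : ℕ) * C + Real.sqrt R * C, by positivity, fun n j m hn hj hm => ?_⟩
      rw [gg_succ_right hn ha hb hab]
      exact step R n m C _ _ hC hn hm (h n j (m + 1) hn (by nlinarith) (by nlinarith))
        (h n j (m - 1) hn (by nlinarith) ((Nat.sub_le _ _).trans (by nlinarith)))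
  | succ k ih =>
    intro R
    obtain ⟨C, hC, h⟩ := ih (R + 1)
    refine ⟨Real.sqrt (R + 1 : ℕ) * C + Real.sqrt R * C, by positivity, fun n j m hn hj hm => ?_⟩
    rw [gg_succ_left hn ha hb hab]
    exact step R n j C _ _ hC hn hj (h n (j + 1) m hn (by nlinarith) (by nlinarith))
        (h n (j - 1) m hn ((Nat.sub_le _ _).trans (by nlinarith)) (by nlinarith))

omit ha hb hab in
lemma tend_add {t : ℝ} {u : ℕ → ℕ} (hu : Tendsto (fun n : ℕ => (u n : ℝ) / n) atTop (𝓝 t)) :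
    Tendsto (fun n : ℕ => ((u n + 1 : ℕ) : ℝ) / n) atTop (𝓝 t) := by
  have := hu.add tendsto_one_div_atTop_nhds_zero_nat
  rw [add_zero] at this
  refine this.congr fun n => ?_
  push_cast; ring

omit ha hb hab in
lemma tend_pos {t : ℝ} (ht : 0 < t) {u : ℕ → ℕ}
    (hu : Tendsto (fun n : ℕ => (u n : ℝ) / n) atTop (𝓝 t)) : ∀ᶠ n in atTop, 1 ≤ u n := by
  filter_upwards [hu.eventually (lt_mem_nhds ht)] with n hn
  by_contra h
  have : u n = 0 := by omega
  simp [this] at hn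

omit ha hb hab in
lemma tend_sub {t : ℝ} (ht : 0 < t) {u : ℕ → ℕ}
    (hu : Tendsto (fun n : ℕ => (u n : ℝ) / n) atTop (𝓝 t)) :
    Tendsto (fun n : ℕ => ((u n - 1 : ℕ) : ℝ) / n) atTop (𝓝 t) := by
  have := hu.sub tendsto_one_div_atTop_nhds_zero_nat
  rw [sub_zero] at this
  refine this.congr' ?_
  filter_upwards [tend_pos ht hu] with n hn
  push_cast [hn]; ring

omit ha hb hab in
lemma tend_sqrt {t : ℝ} {u : ℕ → ℕ}
    (hu : Tendsto (fun n : ℕ => (u n : ℝ) / n) atTop (𝓝 t)) :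
    Tendsto (fun n : ℕ => ((Real.sqrt ((u n : ℝ) / n) : ℝ) : ℂ)) atTop (𝓝 (Real.sqrt t : ℝ)) :=
  (Complex.continuous_ofReal.tendsto _).comp ((Real.continuous_sqrt.tendsto _).comp hu)

lemma gg_lim {t : ℝ} (ht : 0 < t) (k l : ℕ) : ∀ (u v : ℕ → ℕ) (d : ℤ),
    Tendsto (fun n : ℕ => (u n : ℝ) / n) atTop (𝓝 t) →
    Tendsto (fun n : ℕ => (v n : ℝ) / n) atTop (𝓝 t) →
    (∀ᶠ n in atTop, (u n : ℤ) - v n = d) →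
    Tendsto (fun n : ℕ => gg a b n k l (u n) (v n)) atTop
      (𝓝 (((Real.sqrt t : ℝ) : ℂ) ^ (k + l) * gc (a - b) k l d)) := by
  induction k with
  | zero =>
    induction l with
    | zero =>
      intro u v d hu hv hd
      refine tendsto_const_nhds.congr' ?_
      filter_upwards [hd, eventually_ge_atTop 1] with n hn hn1
      rw [gg_zero hn1 ha hb hab, gc_zero]
      simp only [add_zero, pow_zero, one_mul]
      refine if_congr ?_ rfl rfl
      omega
    | succ l ih =>
      intro u v d hu hv hd
      have h1 := ih u (fun n => v n + 1) (d - 1) hu (tend_add hv) (by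
        filter_upwards [hd] with n hn; push_cast; omega)
      have h2 := ih u (fun n => v n - 1) (d + 1) hu (tend_sub ht hv) (by
        filter_upwards [hd, tend_pos ht hv] with n hn hn'; push_cast [hn']; omega)
      have := ((tend_sqrt (tend_add hv)).mul h1).add
        (((tend_sqrt hv).const_mul ((a - b : ℝ) : ℂ)).mul h2)
      have e : ((Real.sqrt t : ℝ) : ℂ) ^ (0 + (l + 1)) * gc (a - b) 0 (l + 1) d =
        (Real.sqrt t : ℝ) * (((Real.sqrt t : ℝ) : ℂ) ^ (0 + l) * gc (a - b) 0 l (d - 1)) +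
        ((a - b : ℝ) : ℂ) * (Real.sqrt t : ℝ) *
          (((Real.sqrt t : ℝ) : ℂ) ^ (0 + l) * gc (a - b) 0 l (d + 1)) := by
        rw [gc_succ_right]; ring
      rw [e]
      refine this.congr' ?_
      filter_upwards [eventually_ge_atTop 1] with n hn1
      rw [gg_succ_right hn1 ha hb hab, Complex.ofReal_mul]
  | succ k ih =>
      intro u v d hu hv hd
      have h1 := ih (fun n => u n + 1) v (d + 1) (tend_add hu) hv (by
        filter_upwards [hd] with n hn; push_cast; omega)
      have h2 := ih (fun n => u n - 1) v (d - 1) (tend_sub ht hu) hv (by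
        filter_upwards [hd, tend_pos ht hu] with n hn hn'; push_cast [hn']; omega)
      have := ((tend_sqrt (tend_add hu)).mul h1).add
        (((tend_sqrt hu).const_mul ((a - b : ℝ) : ℂ)).mul h2)
      have e : ((Real.sqrt t : ℝ) : ℂ) ^ (k + 1 + l) * gc (a - b) (k + 1) l d =
        (Real.sqrt t : ℝ) * (((Real.sqrt t : ℝ) : ℂ) ^ (k + l) * gc (a - b) k l (d + 1)) +
        ((a - b : ℝ) : ℂ) * (Real.sqrt t : ℝ) *
          (((Real.sqrt t : ℝ) : ℂ) ^ (k + l) * gc (a - b) k l (d - 1)) := by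
        rw [gc_succ_left]; ring
      rw [e]
      refine this.congr' ?_
      filter_upwards [eventually_ge_atTop 1] with n hn1
      rw [gg_succ_left hn1 ha hb hab, Complex.ofReal_mul]

end

lemma floor_sum (F : ℕ → ℂ) (n : ℕ) :
    (∫ s in (0 : ℝ)..n, F ⌊s⌋₊) = ∑ j ∈ Finset.range n, F j := by
  have hc : ∀ j : ℕ, ∀ s ∈ Set.uIoo (j : ℝ) ((j + 1 : ℕ) : ℝ), F ⌊s⌋₊ = F j := by
    intro j s hs
    rw [Set.uIoo_of_le (by push_cast; linarith)] at hs
    have : ⌊s⌋₊ = j := by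
      rw [Nat.floor_eq_iff (le_trans (Nat.cast_nonneg j) hs.1.le)]
      exact ⟨hs.1.le, by have := hs.2; push_cast at this; exact this⟩
    rw [this]
  have hi : ∀ j : ℕ, IntervalIntegrable (fun s : ℝ => F ⌊s⌋₊) volume (j : ℝ) ((j + 1 : ℕ) : ℝ) := by
    intro j
    refine (intervalIntegrable_const (c := F j)).congr_uIoo ?_
    intro s hs
    exact (hc j s hs).symm
  have := intervalIntegral.sum_integral_adjacent_intervals (f := fun s : ℝ => F ⌊s⌋₊)
    (μ := volume) (a := fun j : ℕ => (j : ℝ)) (n := n) (fun j _ => hi j)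
  simp only [Nat.cast_zero] at this
  rw [← this]
  refine Finset.sum_congr rfl fun j _ => ?_
  rw [intervalIntegral.integral_congr_uIoo (g := fun _ => F j) (hc j)]
  simp

lemma riemann (F : ℕ → ℕ → ℂ) (Φ : ℝ → ℂ) (C : ℝ)
    (hC : ∀ n j, 1 ≤ n → j ≤ n → ‖F n j‖ ≤ C)
    (hF : ∀ t : ℝ, 0 < t → Tendsto (fun n : ℕ => F n ⌊n * t⌋₊) atTop (𝓝 (Φ t))) :
    Tendsto (fun n : ℕ => (n : ℂ)⁻¹ * ∑ j ∈ Finset.range n, F n j) atTop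
      (𝓝 (∫ t in (0 : ℝ)..1, Φ t)) := by
  have h1 : ∀ n : ℕ, 1 ≤ n → (n : ℂ)⁻¹ * ∑ j ∈ Finset.range n, F n j =
      ∫ t in (0 : ℝ)..1, F n ⌊n * t⌋₊ := by
    intro n hn
    have hn0 : (n : ℝ) ≠ 0 := by exact_mod_cast (by omega : n ≠ 0)
    have := intervalIntegral.integral_comp_mul_left (a := (0 : ℝ)) (b := 1)
      (fun s => F n ⌊s⌋₊) hn0
    rw [this, mul_zero, mul_one, floor_sum]
    rw [Complex.real_smul]; simp
  have h2 : Tendsto (fun n : ℕ => ∫ t in (0 : ℝ)..1, F n ⌊n * t⌋₊) atTop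
      (𝓝 (∫ t in (0 : ℝ)..1, Φ t)) := by
    refine intervalIntegral.tendsto_integral_filter_of_dominated_convergence (fun _ => C) ?_ ?_ ?_ ?_
    · refine Eventually.of_forall fun n => ?_
      refine Measurable.aestronglyMeasurable ?_
      exact (measurable_from_nat (f := F n)).comp (Nat.measurable_floor.comp (by fun_prop))
    · filter_upwards [eventually_ge_atTop 1] with n hn
      refine ae_of_all _ fun t ht => ?_
      rw [Set.uIoc_of_le zero_le_one] at ht
      refine hC n _ hn ?_
      apply Nat.floor_le_of_le
      have : (0 : ℝ) ≤ n := Nat.cast_nonneg n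
      nlinarith [ht.2]
    · exact intervalIntegrable_const
    · refine ae_of_all _ fun t ht => ?_
      rw [Set.uIoc_of_le zero_le_one] at ht
      exact hF t ht.1
  refine h2.congr' ?_
  filter_upwards [eventually_ge_atTop 1] with n hn
  rw [h1 n hn]

lemma sqrt_pow_int (m : ℕ) : ∫ t in (0 : ℝ)..1, Real.sqrt t ^ m = 2 / (m + 2) := by
  have h : ∫ t in (0 : ℝ)..1, Real.sqrt t ^ m = ∫ t in (0 : ℝ)..1, t ^ ((m : ℝ) / 2) := by
    refine intervalIntegral.integral_congr fun t ht => ?_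
    rw [Set.uIcc_of_le zero_le_one] at ht
    rw [Real.sqrt_eq_rpow, ← Real.rpow_natCast, ← Real.rpow_mul ht.1]
    congr 1; ring
  have h2 : (-1 : ℝ) < (m : ℝ) / 2 := by
    have : (0 : ℝ) ≤ m := Nat.cast_nonneg m
    linarith
  rw [h, integral_rpow (Or.inl h2)]
  have : (m : ℝ) / 2 + 1 ≠ 0 := by positivity
  have : (m : ℝ) + 2 ≠ 0 := by positivity
  rw [Real.one_rpow, Real.zero_rpow (by assumption)]
  field_simp
  ring

lemma cesaro {a b : ℝ} (ha : 0 < a) (hb : 0 < b) (hab : a + b = 1) (k l : ℕ) :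
    Tendsto (fun n : ℕ => (n : ℂ)⁻¹ * ∑ j ∈ Finset.range n, gg a b n k l j j) atTop
      (𝓝 (2 / (k + l + 2) * gc (a - b) k l 0)) := by
  obtain ⟨C, _, hC⟩ := gg_bound ha hb hab k l 1
  have := riemann (fun n j => gg a b n k l j j)
    (fun t => ((Real.sqrt t : ℝ) : ℂ) ^ (k + l) * gc (a - b) k l 0) C
    (fun n j hn hj => hC n j j hn (by omega) (by omega)) (by
      intro t ht
      have hfl : Tendsto (fun n : ℕ => ((⌊n * t⌋₊ : ℕ) : ℝ) / n) atTop (𝓝 t) := by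
        have := (tendsto_nat_floor_mul_div_atTop (R := ℝ) ht.le).comp tendsto_natCast_atTop_atTop
        refine this.congr fun n => ?_
        simp [Function.comp_def, mul_comm]
      exact gg_lim ha hb hab ht k l _ _ 0 hfl hfl (Eventually.of_forall fun n => by simp))
  have e : (∫ t in (0 : ℝ)..1, ((Real.sqrt t : ℝ) : ℂ) ^ (k + l) * gc (a - b) k l 0) =
      2 / (k + l + 2) * gc (a - b) k l 0 := by
    rw [intervalIntegral.integral_mul_const]
    congr 1
    have h := sqrt_pow_int (k + l)
    have h2 : (∫ t in (0 : ℝ)..1, ((Real.sqrt t : ℝ) : ℂ) ^ (k + l)) =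
      ((∫ t in (0 : ℝ)..1, Real.sqrt t ^ (k + l) : ℝ) : ℂ) := by
      rw [← intervalIntegral.integral_ofReal]
      simp
    rw [h2, h]; push_cast; ring
  rwa [e] at this

end P5

section P6
open scoped Topology

lemma card_band {p : ℕ} (n K : ℕ) (i0 i1 : Fin p) (h : i1 ≠ i0) :
    (Finset.univ.filter fun s : Fin p → Fin n =>
      (s i0 : ℕ) ≤ s i1 + K ∧ (s i1 : ℕ) ≤ s i0 + K).card ≤ (2 * K + 1) * n ^ (p - 1) := by
  classical
  let f : (Fin p → Fin n) → ({i : Fin p // i ≠ i0} → Fin n) := fun s i => s i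
  set S := (Finset.univ.filter fun s : Fin p → Fin n =>
      (s i0 : ℕ) ≤ s i1 + K ∧ (s i1 : ℕ) ≤ s i0 + K)
  have h1 : S.card ≤ (2 * K + 1) * (S.image f).card := by
    apply Finset.card_le_mul_card_image
    intro r _
    have : (S.filter fun x => f x = r).card ≤
        (Finset.Icc ((r ⟨i1, h⟩ : ℕ) - K) ((r ⟨i1, h⟩ : ℕ) + K)).card := by
      apply Finset.card_le_card_of_injOn (fun s => (s i0 : ℕ))
      · intro s hs
        simp only [Finset.coe_filter, Set.mem_setOf_eq, S, Finset.mem_filter] at hs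
        obtain ⟨⟨_, h2, h3⟩, h4⟩ := hs
        have h5 : r ⟨i1, h⟩ = s i1 := by rw [← h4]
        simp only [Finset.coe_Icc, Set.mem_Icc, h5]
        omega
      · intro s hs t ht hst
        simp only [Finset.coe_filter, Set.mem_setOf_eq] at hs ht
        funext i
        by_cases hi : i = i0
        · subst hi; exact Fin.ext hst
        · have := congrFun (hs.2.trans ht.2.symm) ⟨i, hi⟩
          exact this
    refine this.trans ?_
    rw [Nat.card_Icc]; omega
  refine h1.trans (Nat.mul_le_mul_left _ ?_)
  refine (Finset.card_le_univ _).trans ?_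
  rw [Fintype.card_fun]
  simp

lemma sum_prod_bound {p : ℕ} (n K : ℕ) (C : ℝ) (hC : 0 ≤ C) (A : Fin p → ℕ → ℕ → ℂ)
    (hA : ∀ i j m, j < n → m < n → ‖A i j m‖ ≤ C)
    (hB : ∀ i j m, (K + m < j ∨ K + j < m) → A i j m = 0)
    (σ : Equiv.Perm (Fin p)) (hσ : σ ≠ 1) :
    ‖∑ s : Fin p → Fin n, ∏ i, A i (s i) (s (σ i))‖ ≤ (2 * K + 1) * n ^ (p - 1) * C ^ p := by
  classical
  obtain ⟨i0, hi0⟩ : ∃ i, σ i ≠ i := by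
    by_contra hh; push Not at hh; exact hσ (Equiv.ext hh)
  have hc := card_band n K i0 (σ i0) hi0
  set S := (Finset.univ.filter fun s : Fin p → Fin n =>
      (s i0 : ℕ) ≤ s (σ i0) + K ∧ (s (σ i0) : ℕ) ≤ s i0 + K)
  have h1 : ∑ s : Fin p → Fin n, ∏ i, A i (s i) (s (σ i)) = ∑ s ∈ S, ∏ i, A i (s i) (s (σ i)) := by
    symm
    apply Finset.sum_subset (Finset.subset_univ _)
    intro s _ hs
    apply Finset.prod_eq_zero (Finset.mem_univ i0)
    apply hB
    simp only [S, Finset.mem_filter, Finset.mem_univ, true_and] at hs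
    omega
  rw [h1]
  have h2 : ∀ s ∈ S, ‖∏ i, A i (s i) (s (σ i))‖ ≤ C ^ p := by
    intro s _
    rw [norm_prod]
    refine (Finset.prod_le_prod (fun i _ => norm_nonneg _)
      (fun i _ => hA i _ _ (s i).2 (s (σ i)).2)).trans ?_
    simp
  refine (norm_sum_le_of_le S h2).trans ?_
  rw [Finset.sum_const, nsmul_eq_mul]
  apply mul_le_mul_of_nonneg_right _ (by positivity)
  exact_mod_cast hc

lemma desc_ratio (p : ℕ) :
    Tendsto (fun n : ℕ => ((n.descFactorial p : ℂ))⁻¹ * (n : ℂ) ^ p) atTop (𝓝 1) := by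
  have h := isEquivalent_descFactorial p
  have h2 : Tendsto (fun n : ℕ => ((n : ℝ) ^ p) / (n.descFactorial p : ℝ)) atTop (𝓝 1) := by
    have := (Asymptotics.isEquivalent_iff_tendsto_one (by
      filter_upwards [eventually_ge_atTop p] with n hn
      have := (Nat.descFactorial_pos (n := n) (k := p)).2 hn
      exact_mod_cast this.ne')).1 h.symm
    exact this
  have h3 := (Complex.continuous_ofReal.tendsto _).comp h2
  refine (h3.congr fun n => ?_).trans (by simp)
  simp [div_eq_mul_inv, mul_comm]

lemma joint_lim {a b : ℝ} (ha : 0 < a) (hb : 0 < b) (hab : a + b = 1) {p : ℕ} (hp : 1 ≤ p)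
    (kk ll : Fin p → ℕ) :
    Tendsto (fun n : ℕ => (n.descFactorial p : ℂ)⁻¹ * ∑ s : Fin p → Fin n,
      (Matrix.of fun i j => gg a b n (kk i) (ll i) (s i) (s j)).det) atTop
      (𝓝 (∏ i, (2 / (kk i + ll i + 2) * gc (a - b) (kk i) (ll i) 0 : ℂ))) := by
  classical
  let A : ℕ → Fin p → ℕ → ℕ → ℂ := fun n i => gg a b n (kk i) (ll i)
  choose C0 hC0 hC1 using fun i : Fin p => gg_bound ha hb hab (kk i) (ll i) 1
  set C := ∑ i, C0 i with hCdef
  have hC : 0 ≤ C := Finset.sum_nonneg fun i _ => hC0 i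
  set K := ∑ i, (kk i + ll i) with hK
  have hKi : ∀ i, kk i + ll i ≤ K := fun i =>
    Finset.single_le_sum (f := fun i => kk i + ll i) (fun _ _ => Nat.zero_le _) (Finset.mem_univ i)
  have hA : ∀ n, 1 ≤ n → ∀ i j m, j < n → m < n → ‖A n i j m‖ ≤ C := fun n hn i j m hj hm =>
    (hC1 i n j m hn (by omega) (by omega)).trans
      (Finset.single_le_sum (f := C0) (fun i _ => hC0 i) (Finset.mem_univ i))
  have hB : ∀ n, 1 ≤ n → ∀ i j m, (K + m < j ∨ K + j < m) → A n i j m = 0 := by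
    intro n hn i j m h
    apply gg_band ha hb hab hn
    have := hKi i
    omega
  -- limit of each permutation term
  have hσ : ∀ σ : Equiv.Perm (Fin p), Tendsto (fun n : ℕ => ((n : ℂ) ^ p)⁻¹ *
      ∑ s : Fin p → Fin n, ∏ i, A n i (s i) (s (σ i))) atTop
      (𝓝 (if σ = 1 then (∏ i, (2 / (kk i + ll i + 2) * gc (a - b) (kk i) (ll i) 0 : ℂ)) else 0)) := by
    intro σ
    by_cases h : σ = 1
    · subst h
      rw [if_pos rfl]
      have := tendsto_finset_prod (Finset.univ : Finset (Fin p))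
        (fun i _ => cesaro ha hb hab (kk i) (ll i))
      refine this.congr fun n => ?_
      rw [Finset.prod_mul_distrib]
      congr 1
      · simp
      · simp only [Finset.sum_range]
        rw [Finset.prod_univ_sum]
        rw [Fintype.piFinset_univ]
        rfl
    · rw [if_neg h]
      have hz : Tendsto (fun n : ℕ => ((2 * K + 1) * C ^ p : ℝ) * (n : ℝ)⁻¹) atTop (𝓝 0) := by
        simpa using tendsto_inv_atTop_nhds_zero_nat.const_mul ((2 * K + 1) * C ^ p : ℝ)
      apply squeeze_zero_norm' _ hz
      filter_upwards [eventually_ge_atTop 1] with n hn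
      have hb := sum_prod_bound n K C hC (A n) (hA n hn) (hB n hn) σ h
      have hn0 : (0 : ℝ) < n := by exact_mod_cast hn
      rw [norm_mul, norm_inv, norm_pow, Complex.norm_natCast]
      rw [inv_mul_le_iff₀ (by positivity)]
      refine hb.trans (le_of_eq ?_)
      obtain ⟨q, rfl⟩ : ∃ q, p = q + 1 := ⟨p - 1, by omega⟩
      simp only [Nat.add_sub_cancel]
      field_simp
      ring
  have hsum := tendsto_finset_sum (Finset.univ : Finset (Equiv.Perm (Fin p)))
    (fun σ _ => (hσ σ).const_mul (((Equiv.Perm.sign σ : ℤ) : ℂ)))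
  have hmul := (desc_ratio p).mul hsum
  have e : (1 : ℂ) * ∑ σ : Equiv.Perm (Fin p), (((Equiv.Perm.sign σ : ℤ) : ℂ)) *
      (if σ = 1 then (∏ i, (2 / (kk i + ll i + 2) * gc (a - b) (kk i) (ll i) 0 : ℂ)) else 0) =
      (∏ i, (2 / (kk i + ll i + 2) * gc (a - b) (kk i) (ll i) 0 : ℂ)) := by
    rw [one_mul, Finset.sum_eq_single 1]
    · simp
    · intro σ _ h; simp [h]
    · simp
  rw [e] at hmul
  refine hmul.congr' ?_
  filter_upwards [eventually_ge_atTop 1] with n hn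
  have hn0 : (n : ℂ) ^ p ≠ 0 := by
    apply pow_ne_zero; exact_mod_cast (by omega : n ≠ 0)
  rw [mul_assoc]
  congr 1
  rw [Finset.mul_sum]
  simp only [det_expand, Matrix.of_apply]
  rw [Finset.sum_comm]
  refine Finset.sum_congr rfl fun σ _ => ?_
  rw [← Finset.mul_sum]
  rw [← mul_assoc, mul_comm ((n : ℂ) ^ p), mul_assoc, ← mul_assoc ((n : ℂ) ^ p),
    mul_inv_cancel₀ hn0, one_mul]

end P6

section P7
open scoped Topology

lemma disk_int (τ : ℝ) (k l : ℕ) :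
    ∫ w in Metric.closedBall (0 : ℂ) 1, (w + τ * starRingEnd ℂ w) ^ k *
      (starRingEnd ℂ w + τ * w) ^ l = 2 * π / (k + l + 2) * gc τ k l 0 := by
  rw [← integral_indicator Metric.isClosed_closedBall.measurableSet,
    ← Complex.integral_comp_polarCoord_symm]
  have e : ∀ q ∈ polarCoord.target, q.1 • (Metric.closedBall (0 : ℂ) 1).indicator
      (fun w => (w + τ * starRingEnd ℂ w) ^ k * (starRingEnd ℂ w + τ * w) ^ l)
      (Complex.polarCoord.symm q) =
      (Set.Iic (1 : ℝ)).indicator (fun r : ℝ => (r : ℂ) ^ (k + l + 1)) q.1 * gcI τ k l 0 q.2 := by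
    rintro ⟨r, φ⟩ hq
    simp only [polarCoord_target, Set.mem_prod, Set.mem_Ioi] at hq
    have hr := hq.1
    have hsymm : Complex.polarCoord.symm (r, φ) = r * Complex.exp (φ * Complex.I) := by
      rw [Complex.polarCoord_symm_apply, Complex.exp_mul_I]; simp
    have hnorm : ‖(r * Complex.exp (φ * Complex.I) : ℂ)‖ = r := by
      rw [norm_mul, Complex.norm_exp_ofReal_mul_I, Complex.norm_real, Real.norm_of_nonneg hr.le,
        mul_one]
    have hconj : starRingEnd ℂ (Complex.exp (φ * Complex.I)) = Complex.exp (-(φ * Complex.I)) := by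
      rw [← Complex.exp_conj]; simp
    rw [hsymm]
    by_cases h1 : r ≤ 1
    · rw [Set.indicator_of_mem (by simpa [hnorm, abs_of_pos hr] using h1), Set.indicator_of_mem (by exact h1)]
      simp only [map_mul, Complex.conj_ofReal, hconj, gcI, Int.cast_zero, zero_mul,
        Complex.exp_zero, mul_one, Complex.real_smul]
      have e1 : (r * Complex.exp (φ * Complex.I) + τ * (r * Complex.exp (-(φ * Complex.I))) : ℂ) =
        r * (Complex.exp (φ * Complex.I) + τ * Complex.exp (-(φ * Complex.I))) := by ring
      have e2 : (r * Complex.exp (-(φ * Complex.I)) + τ * (r * Complex.exp (φ * Complex.I)) : ℂ) =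
        r * (Complex.exp (-(φ * Complex.I)) + τ * Complex.exp (φ * Complex.I)) := by ring
      rw [e1, e2, mul_pow, mul_pow]
      ring
    · rw [Set.indicator_of_notMem (by simpa [hnorm, abs_of_pos hr] using h1), Set.indicator_of_notMem (by exact h1)]
      simp
  have hm : MeasurableSet polarCoord.target := by
    rw [polarCoord_target]; exact measurableSet_Ioi.prod measurableSet_Ioo
  rw [setIntegral_congr_fun hm e, polarCoord_target, Measure.volume_eq_prod,
    setIntegral_prod_mul (f := (Set.Iic (1 : ℝ)).indicator (fun r : ℝ => (r : ℂ) ^ (k + l + 1)))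
      (g := gcI τ k l 0)]
  rw [setIntegral_indicator measurableSet_Iic, Set.Ioi_inter_Iic]
  rw [← integral_Ioc_eq_integral_Ioo, ← intervalIntegral.integral_of_le zero_le_one,
    ← intervalIntegral.integral_of_le (by linarith [Real.pi_pos])]
  have h1 : ∫ r in (0 : ℝ)..1, (r : ℂ) ^ (k + l + 1) = 1 / (k + l + 2) := by
    have := integral_pow (a := (0 : ℝ)) (b := 1) (k + l + 1)
    have h2 : ∫ r in (0 : ℝ)..1, (r : ℂ) ^ (k + l + 1) =
        ((∫ r in (0 : ℝ)..1, r ^ (k + l + 1) : ℝ) : ℂ) := by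
      rw [← intervalIntegral.integral_ofReal]; simp
    rw [h2, this]; push_cast; simp; ring
  rw [h1]
  unfold gc
  have hpi : (π : ℂ) ≠ 0 := by exact_mod_cast Real.pi_ne_zero
  field_simp

noncomputable def LL (τ : ℝ) : ℂ →ₗ[ℝ] ℂ := LinearMap.id + τ • Complex.conjAe.toLinearMap

lemma LL_apply (τ : ℝ) (w : ℂ) : LL τ w = w + τ * starRingEnd ℂ w := by
  simp [LL]

lemma LL_re (τ : ℝ) (w : ℂ) : (LL τ w).re = (1 + τ) * w.re := by
  simp [LL_apply]; ring

lemma LL_im (τ : ℝ) (w : ℂ) : (LL τ w).im = (1 - τ) * w.im := by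
  simp [LL_apply]; ring

lemma LL_det {τ : ℝ} (h1 : 1 + τ ≠ 0) (h2 : 1 - τ ≠ 0) : LinearMap.det (LL τ) ≠ 0 := by
  intro h
  have := LinearMap.bot_lt_ker_of_det_eq_zero h
  apply this.ne'
  rw [LinearMap.ker_eq_bot']
  intro m hm
  have hr := congrArg Complex.re hm
  have hi := congrArg Complex.im hm
  rw [LL_re] at hr
  rw [LL_im] at hi
  apply Complex.ext
  · simpa [h1] using hr
  · simpa [h2] using hi

lemma LL_preimage {θ : ℝ} (hθ : θ ∈ Set.Ioo 0 (π / 2)) :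
    LL (cos θ ^ 2 - sin θ ^ 2) ⁻¹' solidEllipse θ = Metric.closedBall 0 1 := by
  obtain ⟨ha, hb, hab⟩ := sc_facts hθ
  ext w
  simp only [Set.mem_preimage, solidEllipse, Set.mem_ofPred_eq, LL_re, LL_im,
    mem_closedBall_zero_iff]
  have e1 : 1 + (cos θ ^ 2 - sin θ ^ 2) = 2 * cos θ ^ 2 := by linarith
  have e2 : 1 - (cos θ ^ 2 - sin θ ^ 2) = 2 * sin θ ^ 2 := by linarith
  rw [e1, e2]
  have e3 : (2 * cos θ ^ 2 * w.re) ^ 2 / (4 * cos θ ^ 4) = w.re ^ 2 := by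
    have : cos θ ≠ 0 := by rintro h; simp [h] at ha
    field_simp; ring
  have e4 : (2 * sin θ ^ 2 * w.im) ^ 2 / (4 * sin θ ^ 4) = w.im ^ 2 := by
    have : sin θ ≠ 0 := by rintro h; simp [h] at hb
    field_simp; ring
  rw [e3, e4]
  rw [← sq_le_one_iff₀ (norm_nonneg w), Complex.sq_norm, Complex.normSq_apply]
  ring_nf

lemma solid_closed (θ : ℝ) : IsClosed (solidEllipse θ) := by
  apply isClosed_le _ continuous_const
  fun_prop

lemma ellipse_map {θ : ℝ} (hθ : θ ∈ Set.Ioo 0 (π / 2)) :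
    ellipseUniform θ = (volume (Metric.closedBall (0 : ℂ) 1))⁻¹ •
      (volume.restrict (Metric.closedBall (0 : ℂ) 1)).map (LL (cos θ ^ 2 - sin θ ^ 2)) := by
  obtain ⟨ha, hb, hab⟩ := sc_facts hθ
  have hdet : LinearMap.det (LL (cos θ ^ 2 - sin θ ^ 2)) ≠ 0 := LL_det (by linarith) (by linarith)
  have hmap := Measure.map_linearMap_addHaar_eq_smul_addHaar (volume : Measure ℂ) hdet
  have hmeas : Measurable (LL (cos θ ^ 2 - sin θ ^ 2)) :=
    (LinearMap.continuous_of_finiteDimensional _).measurable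
  rw [← LL_preimage hθ, ← Measure.restrict_map hmeas (solid_closed θ).measurableSet,
    ← Measure.map_apply hmeas (solid_closed θ).measurableSet, hmap]
  unfold ellipseUniform
  rw [Measure.restrict_smul, smul_smul, Measure.smul_apply]
  congr 1
  set c := ENNReal.ofReal |(LinearMap.det (LL (cos θ ^ 2 - sin θ ^ 2)))⁻¹| with hc
  have hc0 : c ≠ 0 := by
    rw [hc]; simp [hdet]
  have hc1 : c ≠ ⊤ := ENNReal.ofReal_ne_top
  rw [smul_eq_mul, ENNReal.mul_inv (Or.inl hc0) (Or.inl hc1), mul_right_comm,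
    ENNReal.inv_mul_cancel hc0 hc1, one_mul]

lemma ellipse_prob {θ : ℝ} (hθ : θ ∈ Set.Ioo 0 (π / 2)) :
    IsProbabilityMeasure (ellipseUniform θ) := by
  rw [ellipse_map hθ]
  have hmeas : Measurable (LL (cos θ ^ 2 - sin θ ^ 2)) :=
    (LinearMap.continuous_of_finiteDimensional _).measurable
  constructor
  rw [Measure.smul_apply, Measure.map_apply hmeas MeasurableSet.univ]
  simp only [Set.preimage_univ, Measure.restrict_apply_univ, smul_eq_mul]
  apply ENNReal.inv_mul_cancel
  · exact (Metric.measure_closedBall_pos _ _ one_pos).ne'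
  · exact measure_closedBall_lt_top.ne

lemma ellipse_moment {θ : ℝ} (hθ : θ ∈ Set.Ioo 0 (π / 2)) (k l : ℕ) :
    ∫ z, z ^ k * starRingEnd ℂ z ^ l ∂(ellipseUniform θ) =
      2 / (k + l + 2) * gc (cos θ ^ 2 - sin θ ^ 2) k l 0 := by
  rw [ellipse_map hθ, integral_smul_measure]
  have hmeas : Measurable (LL (cos θ ^ 2 - sin θ ^ 2)) :=
    (LinearMap.continuous_of_finiteDimensional _).measurable
  rw [integral_map hmeas.aemeasurable (by
    have : Continuous fun z : ℂ => z ^ k * starRingEnd ℂ z ^ l := by fun_prop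
    exact this.aestronglyMeasurable)]
  have := disk_int (cos θ ^ 2 - sin θ ^ 2) k l
  simp only [LL_apply, map_add, map_mul, Complex.conj_conj, Complex.conj_ofReal]
  rw [this, Complex.volume_closedBall]
  have hpi : (π : ℂ) ≠ 0 := by exact_mod_cast Real.pi_ne_zero
  simp
  field_simp

lemma ellipse_bdd {θ : ℝ} (hθ : θ ∈ Set.Ioo 0 (π / 2)) :
    ∀ᵐ z ∂(ellipseUniform θ), ‖z‖ ≤ 2 := by
  obtain ⟨ha, hb, hab⟩ := sc_facts hθ
  rw [ellipse_map hθ]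
  have hmeas : Measurable (LL (cos θ ^ 2 - sin θ ^ 2)) :=
    (LinearMap.continuous_of_finiteDimensional _).measurable
  apply Measure.ae_smul_measure
  rw [ae_map_iff hmeas.aemeasurable (by
    exact (isClosed_le continuous_norm continuous_const).measurableSet)]
  filter_upwards [ae_restrict_mem Metric.isClosed_closedBall.measurableSet] with w hw
  rw [mem_closedBall_zero_iff] at hw
  rw [LL_apply]
  refine (norm_add_le _ _).trans ?_
  rw [norm_mul, RCLike.norm_conj, Complex.norm_real, Real.norm_eq_abs]
  have : |cos θ ^ 2 - sin θ ^ 2| ≤ 1 := by rw [abs_le]; constructor <;> linarith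
  nlinarith [norm_nonneg w]

lemma pi_moment {θ : ℝ} (hθ : θ ∈ Set.Ioo 0 (π / 2)) {p : ℕ} (kk ll : Fin p → ℕ) :
    ∫ z, (∏ i, (z i) ^ kk i * (starRingEnd ℂ (z i)) ^ ll i)
            ∂(Measure.pi fun _ : Fin p => ellipseUniform θ) =
    ∏ i, (2 / (kk i + ll i + 2) * gc (cos θ ^ 2 - sin θ ^ 2) (kk i) (ll i) 0 : ℂ) := by
  have := ellipse_prob hθ
  rw [integral_fintype_prod_eq_prod (f := fun i z => z ^ kk i * (starRingEnd ℂ z) ^ ll i)]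
  refine Finset.prod_congr rfl fun i _ => ellipse_moment hθ _ _

lemma pi_bdd {θ : ℝ} (hθ : θ ∈ Set.Ioo 0 (π / 2)) {p : ℕ} :
    ∀ᵐ z ∂(Measure.pi fun _ : Fin p => ellipseUniform θ), ∀ i, ‖z i‖ ≤ 2 := by
  have := ellipse_prob hθ
  rw [ae_all_iff]
  intro i
  exact (measurePreserving_eval (fun _ : Fin p => ellipseUniform θ) i).quasiMeasurePreserving.ae
    (ellipse_bdd hθ)

lemma moment_lim {θ : ℝ} (hθ : θ ∈ Set.Ioo 0 (π / 2)) {p : ℕ} (hp : 1 ≤ p) (kk ll : Fin p → ℕ) :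
      Tendsto (fun n : ℕ =>
          ∫ z, (∏ i, (z i) ^ kk i * (starRingEnd ℂ (z i)) ^ ll i)
            ∂(marginal n p (nuTheta θ n))) atTop
        (nhds (∫ z, (∏ i, (z i) ^ kk i * (starRingEnd ℂ (z i)) ^ ll i)
            ∂(Measure.pi fun _ : Fin p => ellipseUniform θ))) := by
  obtain ⟨ha, hb, hab⟩ := sc_facts hθ
  rw [pi_moment hθ]
  refine (joint_lim ha hb hab hp kk ll).congr' ?_
  filter_upwards [eventually_ge_atTop p] with n hn
  rw [marg_integral hθ hp hn kk ll]

end P7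

section P8
open scoped Topology

/-- Star monomials. -/
noncomputable def mono {p : ℕ} (K : (Fin p → ℕ) × (Fin p → ℕ)) (z : Fin p → ℂ) : ℂ :=
  ∏ i, (z i) ^ K.1 i * (starRingEnd ℂ (z i)) ^ K.2 i

/-- Star polynomials. -/
noncomputable def SP (p : ℕ) : Submodule ℂ ((Fin p → ℂ) → ℂ) := Submodule.span ℂ (Set.range mono)

/-- Squared radius. -/
noncomputable def SS {p : ℕ} (z : Fin p → ℂ) : ℝ := ∑ i, ‖z i‖ ^ 2

lemma SS_nonneg {p : ℕ} (z : Fin p → ℂ) : 0 ≤ SS z := Finset.sum_nonneg fun _ _ => by positivity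

lemma SS_cont {p : ℕ} : Continuous (SS : (Fin p → ℂ) → ℝ) := by unfold SS; fun_prop

lemma mono_cont' {p : ℕ} (K : (Fin p → ℕ) × (Fin p → ℕ)) : Continuous (mono K) := by
  unfold mono; fun_prop

lemma mono_mem {p : ℕ} (K : (Fin p → ℕ) × (Fin p → ℕ)) : mono K ∈ SP p :=
  Submodule.subset_span ⟨K, rfl⟩

lemma mono_mul {p : ℕ} (K L : (Fin p → ℕ) × (Fin p → ℕ)) :
    mono K * mono L = mono (K + L) := by
  funext z
  simp only [mono, Pi.mul_apply, ← Finset.prod_mul_distrib, Prod.fst_add, Prod.snd_add,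
    Pi.add_apply, pow_add]
  exact Finset.prod_congr rfl fun i _ => by ring

lemma mono_zero {p : ℕ} : mono (0 : (Fin p → ℕ) × (Fin p → ℕ)) = 1 := by
  funext z; simp [mono]

lemma SP_mul {p : ℕ} {f g : (Fin p → ℂ) → ℂ} (hf : f ∈ SP p) (hg : g ∈ SP p) : f * g ∈ SP p := by
  unfold SP at hf hg ⊢
  induction hf, hg using Submodule.span_induction₂ with
  | mem_mem x y hx hy =>
    obtain ⟨K, rfl⟩ := hx
    obtain ⟨L, rfl⟩ := hy
    rw [mono_mul]; exact mono_mem _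
  | zero_left y hy => simp
  | zero_right x hx => simp
  | add_left x y z _ _ _ h1 h2 => rw [add_mul]; exact Submodule.add_mem _ h1 h2
  | add_right x y z _ _ _ h1 h2 => rw [mul_add]; exact Submodule.add_mem _ h1 h2
  | smul_left r x y _ _ h => rw [smul_mul_assoc]; exact Submodule.smul_mem _ _ h
  | smul_right r x y _ _ h => rw [mul_smul_comm]; exact Submodule.smul_mem _ _ h

lemma SP_one {p : ℕ} : (1 : (Fin p → ℂ) → ℂ) ∈ SP p := by
  rw [← mono_zero]; exact mono_mem _

lemma SP_pow {p : ℕ} {f : (Fin p → ℂ) → ℂ} (hf : f ∈ SP p) (M : ℕ) : f ^ M ∈ SP p := by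
  induction M with
  | zero => rw [pow_zero]; exact SP_one
  | succ M ih => rw [pow_succ]; exact SP_mul ih hf

lemma SP_star {p : ℕ} {f : (Fin p → ℂ) → ℂ} (hf : f ∈ SP p) :
    (fun z => starRingEnd ℂ (f z)) ∈ SP p := by
  unfold SP at hf
  induction hf using Submodule.span_induction with
  | mem x hx =>
    obtain ⟨K, rfl⟩ := hx
    have : (fun z => starRingEnd ℂ (mono K z)) = mono (K.2, K.1) := by
      funext z
      simp [mono, map_prod, mul_comm]
    rw [this]; exact mono_mem _
  | zero =>
    convert Submodule.zero_mem (SP p) using 1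
    funext z; simp
  | add x y _ _ h1 h2 =>
    convert Submodule.add_mem _ h1 h2 using 1
    funext z; simp
  | smul c x _ h =>
    convert Submodule.smul_mem _ (starRingEnd ℂ c) h using 1
    funext z; simp

lemma coord_mem {p : ℕ} (i : Fin p) : (fun z : Fin p → ℂ => z i) ∈ SP p := by
  have : (fun z : Fin p → ℂ => z i) = mono (Pi.single i 1, 0) := by
    funext z
    simp only [mono, Pi.zero_apply, pow_zero, mul_one]
    rw [Finset.prod_eq_single i]
    · simp
    · intro j _ h; simp [h]
    · simp
  rw [this]; exact mono_mem _

lemma SS_mem {p : ℕ} (M : ℕ) : (fun z : Fin p → ℂ => ((SS z ^ M : ℝ) : ℂ)) ∈ SP p := by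
  have h : (fun z : Fin p → ℂ => ((SS z : ℝ) : ℂ)) ∈ SP p := by
    have : (fun z : Fin p → ℂ => ((SS z : ℝ) : ℂ)) =
        ∑ i : Fin p, (fun z : Fin p → ℂ => z i) * (fun z => starRingEnd ℂ (z i)) := by
      funext z
      simp [SS, Complex.mul_conj, Complex.normSq_eq_norm_sq]
    rw [this]
    exact Submodule.sum_mem _ fun i _ => SP_mul (coord_mem i) (SP_star (coord_mem i))
  have e : (fun z : Fin p → ℂ => ((SS z ^ M : ℝ) : ℂ)) =
      (fun z : Fin p → ℂ => ((SS z : ℝ) : ℂ)) ^ M := by funext z; simp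
  rw [e]; exact SP_pow h M

lemma SP_cont {p : ℕ} {f : (Fin p → ℂ) → ℂ} (hf : f ∈ SP p) : Continuous f := by
  unfold SP at hf
  induction hf using Submodule.span_induction with
  | mem x hx => obtain ⟨K, rfl⟩ := hx; exact mono_cont' K
  | zero => exact continuous_const
  | add x y _ _ h1 h2 => exact h1.add h2
  | smul c x _ h => exact h.const_smul c

lemma SP_growth {p : ℕ} {f : (Fin p → ℂ) → ℂ} (hf : f ∈ SP p) :
    ∃ C : ℝ, ∃ D : ℕ, 0 ≤ C ∧ ∀ z, ‖f z‖ ≤ C * (1 + SS z) ^ D := by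
  unfold SP at hf
  induction hf using Submodule.span_induction with
  | mem x hx =>
    obtain ⟨K, rfl⟩ := hx
    refine ⟨1, ∑ i, (K.1 i + K.2 i), zero_le_one, fun z => ?_⟩
    rw [one_mul, ← Finset.prod_pow_eq_pow_sum, mono, norm_prod]
    refine Finset.prod_le_prod (fun i _ => norm_nonneg _) fun i _ => ?_
    rw [norm_mul, norm_pow, norm_pow, RCLike.norm_conj, ← pow_add]
    refine pow_le_pow_left₀ (norm_nonneg _) ?_ _
    have h1 : ‖z i‖ ^ 2 ≤ SS z :=
      Finset.single_le_sum (f := fun i => ‖z i‖ ^ 2) (fun _ _ => by positivity) (Finset.mem_univ i)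
    nlinarith [sq_nonneg (‖z i‖ - 1)]
  | zero => exact ⟨0, 0, le_rfl, fun z => by simp⟩
  | add x y _ _ h1 h2 =>
    obtain ⟨C, D, hC, h1⟩ := h1
    obtain ⟨C', D', hC', h2⟩ := h2
    refine ⟨C + C', D + D', by positivity, fun z => ?_⟩
    have hs := SS_nonneg z
    refine (norm_add_le _ _).trans ?_
    have e1 : (1 + SS z) ^ D ≤ (1 + SS z) ^ (D + D') :=
      pow_le_pow_right₀ (by linarith) (by omega)
    have e2 : (1 + SS z) ^ D' ≤ (1 + SS z) ^ (D + D') :=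
      pow_le_pow_right₀ (by linarith) (by omega)
    rw [add_mul]
    exact add_le_add ((h1 z).trans (by gcongr)) ((h2 z).trans (by gcongr))
  | smul c x _ h =>
    obtain ⟨C, D, hC, h⟩ := h
    refine ⟨‖c‖ * C, D, by positivity, fun z => ?_⟩
    rw [Pi.smul_apply, norm_smul, mul_assoc]
    gcongr
    exact h z

lemma SP_lim {p : ℕ} {μs : ℕ → Measure (Fin p → ℂ)} {μ : Measure (Fin p → ℂ)}
    (hint : ∀ K, ∀ᶠ n in atTop, Integrable (mono K) (μs n))
    (hint' : ∀ K, Integrable (mono K) μ)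
    (hlim : ∀ K, Tendsto (fun n => ∫ z, mono K z ∂(μs n)) atTop (𝓝 (∫ z, mono K z ∂μ)))
    {f : (Fin p → ℂ) → ℂ} (hf : f ∈ SP p) :
    (∀ᶠ n in atTop, Integrable f (μs n)) ∧ Integrable f μ ∧
    Tendsto (fun n => ∫ z, f z ∂(μs n)) atTop (𝓝 (∫ z, f z ∂μ)) := by
  unfold SP at hf
  induction hf using Submodule.span_induction with
  | mem x hx => obtain ⟨K, rfl⟩ := hx; exact ⟨hint K, hint' K, hlim K⟩
  | zero =>
    refine ⟨Eventually.of_forall fun n => integrable_zero _ _ _, integrable_zero _ _ _, ?_⟩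
    simp
  | add x y _ _ h1 h2 =>
    obtain ⟨a1, b1, c1⟩ := h1
    obtain ⟨a2, b2, c2⟩ := h2
    refine ⟨(a1.and a2).mono fun n h => h.1.add h.2, b1.add b2, ?_⟩
    simp only [Pi.add_apply]
    rw [integral_add b1 b2]
    refine (c1.add c2).congr' ?_
    filter_upwards [a1, a2] with n h1 h2
    rw [integral_add h1 h2]
  | smul c x _ h =>
    obtain ⟨a1, b1, c1⟩ := h
    refine ⟨a1.mono fun n h => h.smul c, b1.smul c, ?_⟩
    simp only [Pi.smul_apply, integral_smul]
    exact c1.const_smul c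

lemma SP_approx {p : ℕ} (X : Set (Fin p → ℂ)) (hX : IsCompact X)
    (f : (Fin p → ℂ) → ℂ) (hf : Continuous f) {ε : ℝ} (hε : 0 < ε) :
    ∃ q ∈ SP p, ∀ z ∈ X, ‖f z - q z‖ ≤ ε := by
  have : CompactSpace X := isCompact_iff_compactSpace.1 hX
  let A : StarSubalgebra ℂ C(X, ℂ) :=
    { carrier := {g | ∃ q ∈ SP p, ∀ x : X, g x = q x}
      mul_mem' := by
        rintro g h ⟨q, hq, e⟩ ⟨r, hr, e'⟩
        exact ⟨q * r, SP_mul hq hr, fun x => by simp [e, e']⟩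
      add_mem' := by
        rintro g h ⟨q, hq, e⟩ ⟨r, hr, e'⟩
        exact ⟨q + r, Submodule.add_mem _ hq hr, fun x => by simp [e, e']⟩
      algebraMap_mem' := by
        intro c
        exact ⟨c • 1, Submodule.smul_mem _ _ SP_one, fun x => by simp⟩
      star_mem' := by
        rintro g ⟨q, hq, e⟩
        exact ⟨_, SP_star hq, fun x => by simp [e]⟩ }
  have hA : A.SeparatesPoints := by
    intro x y hxy
    obtain ⟨i, hi⟩ : ∃ i, x.1 i ≠ y.1 i := by
      by_contra h; push Not at h; exact hxy (Subtype.ext (funext h))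
    refine ⟨fun x => x.1 i, ⟨⟨fun x : X => x.1 i, (continuous_apply i).comp continuous_subtype_val⟩, ?_, rfl⟩, hi⟩
    exact ⟨_, coord_mem i, fun x => rfl⟩
  have hd := ContinuousMap.starSubalgebra_topologicalClosure_eq_top_of_separatesPoints A hA
  let F : C(X, ℂ) := ⟨fun x => f x, by fun_prop⟩
  have hF : F ∈ closure (A : Set C(X, ℂ)) := by
    rw [← StarSubalgebra.topologicalClosure_coe, hd]; trivial
  obtain ⟨g, ⟨q, hq, e⟩, hg⟩ := Metric.mem_closure_iff.1 hF ε hε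
  refine ⟨q, hq, fun z hz => ?_⟩
  have := (ContinuousMap.dist_apply_le_dist (f := F) (g := g) ⟨z, hz⟩).trans hg.le
  rw [dist_eq_norm, e] at this
  exact this

lemma weak_of_moments {p : ℕ} {μs : ℕ → Measure (Fin p → ℂ)} {μ : Measure (Fin p → ℂ)}
    (hP : ∀ᶠ n in atTop, IsProbabilityMeasure (μs n)) [IsProbabilityMeasure μ]
    (hint : ∀ K, ∀ᶠ n in atTop, Integrable (mono K) (μs n))
    (hbd : ∀ᵐ z ∂μ, ∀ i, ‖z i‖ ≤ 2)
    (hlim : ∀ K, Tendsto (fun n => ∫ z, mono K z ∂(μs n)) atTop (𝓝 (∫ z, mono K z ∂μ)))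
    (f : BoundedContinuousFunction (Fin p → ℂ) ℝ) :
    Tendsto (fun n => ∫ z, f z ∂(μs n)) atTop (𝓝 (∫ z, f z ∂μ)) := by
  have hSbd : ∀ᵐ z ∂μ, SS z ≤ 4 * p := by
    filter_upwards [hbd] with z hz
    have : SS z ≤ ∑ i : Fin p, (4 : ℝ) :=
      Finset.sum_le_sum fun i _ => by nlinarith [hz i, norm_nonneg (z i)]
    simpa [mul_comm] using this
  have hint' : ∀ K, Integrable (mono K) μ := by
    intro K
    obtain ⟨C, D, hC, h⟩ := SP_growth (mono_mem K)
    refine Integrable.of_bound (mono_cont' K).aestronglyMeasurable (C * (1 + 4 * p) ^ D) ?_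
    filter_upwards [hSbd] with z hz
    refine (h z).trans ?_
    have := SS_nonneg z
    gcongr
  have L := fun {g} (hg : g ∈ SP p) => SP_lim hint hint' hlim hg
  -- main estimate
  have key : ∀ ε : ℝ, 0 < ε → ∀ᶠ n in atTop, ‖∫ z, f z ∂(μs n) - ∫ z, f z ∂μ‖ ≤ 6 * ε := by
    intro ε hε
    set T : ℝ := 8 * p + 1 with hT
    have hT1 : 1 ≤ T := by rw [hT]; have : (0:ℝ) ≤ p := Nat.cast_nonneg p; linarith
    have hXc : IsCompact {z : Fin p → ℂ | SS z ≤ T} := by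
      apply Metric.isCompact_of_isClosed_isBounded (isClosed_le SS_cont continuous_const)
      refine (Metric.isBounded_closedBall (x := (0 : Fin p → ℂ)) (r := T)).subset fun z hz => ?_
      rw [mem_closedBall_zero_iff, pi_norm_le_iff_of_nonneg (by linarith)]
      intro i
      have h1 : ‖z i‖ ^ 2 ≤ SS z :=
        Finset.single_le_sum (f := fun i => ‖z i‖ ^ 2) (fun _ _ => by positivity)
          (Finset.mem_univ i)
      have h2 : SS z ≤ T := hz
      nlinarith [norm_nonneg (z i)]
    obtain ⟨q, hq, hqX⟩ := SP_approx _ hXc (fun z => (f z : ℂ)) (by fun_prop) hε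
    obtain ⟨C, D, hC, hqg⟩ := SP_growth hq
    set C2 : ℝ := (‖f‖ + C * 2 ^ D) * T ^ D with hC2
    have hC2n : 0 ≤ C2 := by positivity
    obtain ⟨M0, hM0⟩ : ∃ M : ℕ, C2 * (1 / 2 : ℝ) ^ M ≤ ε := by
      have : Tendsto (fun M : ℕ => C2 * (1 / 2 : ℝ) ^ M) atTop (𝓝 0) := by
        simpa using (tendsto_pow_atTop_nhds_zero_of_lt_one (r := (1 / 2 : ℝ)) (by norm_num)
          (by norm_num)).const_mul C2
      exact ((this.eventually (Iic_mem_nhds hε)).exists)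
    set M := M0 + D with hM
    have hM1 : C2 * (1 / 2 : ℝ) ^ M ≤ ε := by
      refine le_trans ?_ hM0
      apply mul_le_mul_of_nonneg_left _ hC2n
      exact pow_le_pow_of_le_one (by norm_num) (by norm_num) (by omega)
    let H : (Fin p → ℂ) → ℝ := fun z => ε + C2 / T ^ M * SS z ^ M
    have hpt : ∀ z, ‖(f z : ℂ) - q z‖ ≤ H z := by
      intro z
      have hs := SS_nonneg z
      by_cases hz : SS z ≤ T
      · refine (hqX z hz).trans ?_
        have : 0 ≤ C2 / T ^ M * SS z ^ M := by positivity
        simp only [H]; linarith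
      · push Not at hz
        have h1 : ‖(f z : ℂ) - q z‖ ≤ ‖f‖ + C * (1 + SS z) ^ D := by
          refine (norm_sub_le _ _).trans (add_le_add ?_ (hqg z))
          rw [Complex.norm_real]; exact f.norm_coe_le_norm z
        have hs1 : 1 ≤ SS z := by linarith
        have h2 : (1 + SS z) ^ D ≤ 2 ^ D * SS z ^ D := by
          rw [← mul_pow]; gcongr; linarith
        have h3 : 1 ≤ SS z ^ D := one_le_pow₀ hs1
        have h4 : ‖f‖ + C * (1 + SS z) ^ D ≤ (‖f‖ + C * 2 ^ D) * SS z ^ D := by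
          have := mul_le_mul_of_nonneg_left h2 hC
          nlinarith [norm_nonneg f]
        have hTM : 0 < T ^ M := by positivity
        have h5 : SS z ^ D ≤ T ^ D / T ^ M * SS z ^ M := by
          rw [hM, pow_add, pow_add]
          have : T ^ M0 ≤ SS z ^ M0 := by gcongr
          have hTT : T ≠ 0 := by linarith
          rw [div_mul_eq_mul_div, le_div_iff₀ (by positivity)]
          have hx : 0 ≤ SS z ^ D * T ^ D := by positivity
          nlinarith [mul_le_mul_of_nonneg_left this hx]
        have h6 : (‖f‖ + C * 2 ^ D) * SS z ^ D ≤ C2 / T ^ M * SS z ^ M := by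
          refine (mul_le_mul_of_nonneg_left h5 (by positivity)).trans (le_of_eq ?_)
          rw [hC2]; ring
        simp only [H]; linarith
    have hdom : ∀ ρ : Measure (Fin p → ℂ), IsProbabilityMeasure ρ → Integrable q ρ →
        Integrable (fun z => ((SS z ^ M : ℝ) : ℂ)) ρ →
        ‖((∫ z, f z ∂ρ : ℝ) : ℂ) - ∫ z, q z ∂ρ‖ ≤ ε + C2 / T ^ M * ∫ z, SS z ^ M ∂ρ := by
      intro ρ hρ hqi hSi
      have hSi' : Integrable (fun z => SS z ^ M) ρ := by
        exact hSi.re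
      have hfi : Integrable (fun z => (f z : ℂ)) ρ := (f.integrable ρ).ofReal
      rw [← integral_complex_ofReal, ← integral_sub hfi hqi]
      have hH : Integrable H ρ := (integrable_const ε).add (hSi'.const_mul _)
      refine (norm_integral_le_of_norm_le hH (ae_of_all _ hpt)).trans (le_of_eq ?_)
      simp only [H]
      rw [integral_add (integrable_const ε) (hSi'.const_mul _), integral_const_mul]
      simp
    obtain ⟨q1, q2, q3⟩ := L hq
    obtain ⟨s1, s2, s3⟩ := L (SS_mem (p := p) M)
    have s3' : Tendsto (fun n => ∫ z, SS z ^ M ∂(μs n)) atTop (𝓝 (∫ z, SS z ^ M ∂μ)) := by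
      have := (Complex.continuous_re.tendsto _).comp s3
      simpa only [Function.comp_def, integral_complex_ofReal, Complex.ofReal_re] using this
    have hmu : C2 / T ^ M * ∫ z, SS z ^ M ∂μ ≤ ε := by
      have h1 : ∫ z, SS z ^ M ∂μ ≤ (T / 2) ^ M := by
        have hSi' : Integrable (fun z => SS z ^ M) μ := by exact s2.re
        have : ∫ z, SS z ^ M ∂μ ≤ ∫ z, (T / 2) ^ M ∂μ := by
          refine integral_mono_ae hSi' (integrable_const _) ?_
          filter_upwards [hSbd] with z hz
          exact pow_le_pow_left₀ (SS_nonneg z) (by rw [hT]; linarith) M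
        simpa using this
      refine (mul_le_mul_of_nonneg_left h1 (by positivity)).trans (le_trans (le_of_eq ?_) hM1)
      have : T ≠ 0 := by linarith
      rw [div_pow, div_pow, one_pow]; field_simp
    have hev : ∀ᶠ n in atTop, C2 / T ^ M * ∫ z, SS z ^ M ∂(μs n) ≤ 2 * ε := by
      have := s3'.const_mul (C2 / T ^ M)
      exact (this.eventually (Iio_mem_nhds (by linarith : _ < 2 * ε))).mono fun n h => le_of_lt h
    have hqe : ∀ᶠ n in atTop, ‖∫ z, q z ∂(μs n) - ∫ z, q z ∂μ‖ ≤ ε := by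
      have := Metric.tendsto_nhds.1 q3 ε hε
      exact this.mono fun n h => by rw [← dist_eq_norm]; exact h.le
    filter_upwards [hP, q1, s1, hev, hqe] with n h1 h2 h3 h4 h5
    have d1 := hdom (μs n) h1 h2 h3
    have d2 := hdom μ inferInstance q2 s2
    have e : ‖∫ z, f z ∂(μs n) - ∫ z, f z ∂μ‖ =
        ‖((∫ z, f z ∂(μs n) : ℝ) : ℂ) - ((∫ z, f z ∂μ : ℝ) : ℂ)‖ := by
      rw [← Complex.ofReal_sub, Complex.norm_real]
    rw [e]
    have t1 := norm_sub_le_norm_sub_add_norm_sub ((∫ z, f z ∂(μs n) : ℝ) : ℂ)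
      (∫ z, q z ∂(μs n)) ((∫ z, f z ∂μ : ℝ) : ℂ)
    have t2 := norm_sub_le_norm_sub_add_norm_sub (∫ z, q z ∂(μs n)) (∫ z, q z ∂μ)
      ((∫ z, f z ∂μ : ℝ) : ℂ)
    rw [norm_sub_rev (∫ z, q z ∂μ)] at t2
    linarith
  rw [Metric.tendsto_nhds]
  intro ε hε
  filter_upwards [key (ε / 7) (by positivity)] with n hn
  rw [dist_eq_norm]
  linarith

end P8

section P9
lemma theta_nonneg (θ : ℝ) (n : ℕ) (d : Fin n → ℂ) : 0 ≤ thetaDensity θ n d := by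
  unfold thetaDensity
  apply mul_nonneg _ (Real.exp_pos _).le
  refine Finset.prod_nonneg fun i _ => Finset.prod_nonneg fun j _ => ?_
  split_ifs <;> positivity

lemma theta_int_pos {θ : ℝ} (hθ : θ ∈ Set.Ioo 0 (π / 2)) {n : ℕ} (hn : 1 ≤ n) :
    0 < ∫ d : Fin n → ℂ, thetaDensity θ n d := by
  obtain ⟨ha, hb, hab⟩ := sc_facts hθ
  rw [theta_integral hθ hn]
  have := NN_pos ha hb hab hn
  have := Nat.factorial_pos n
  positivity

lemma nu_prob {θ : ℝ} (hθ : θ ∈ Set.Ioo 0 (π / 2)) {n : ℕ} (hn : 1 ≤ n) :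
    IsProbabilityMeasure (nuTheta θ n) := by
  constructor
  unfold nuTheta
  rw [Measure.smul_apply, withDensity_apply _ MeasurableSet.univ, Measure.restrict_univ,
    ← ofReal_integral_eq_lintegral_ofReal (theta_integrable hθ hn)
      (ae_of_all _ (theta_nonneg θ n)), smul_eq_mul]
  apply ENNReal.inv_mul_cancel
  · simpa using theta_int_pos hθ hn
  · exact ENNReal.ofReal_ne_top

lemma weak_lim {θ : ℝ} (hθ : θ ∈ Set.Ioo 0 (π / 2)) {p : ℕ} (hp : 1 ≤ p)
    (f : BoundedContinuousFunction (Fin p → ℂ) ℝ) :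
      Tendsto (fun n : ℕ => ∫ x, f x ∂(marginal n p (nuTheta θ n))) atTop
        (nhds (∫ x, f x ∂(Measure.pi fun _ : Fin p => ellipseUniform θ))) := by
  have := ellipse_prob hθ
  refine weak_of_moments ?_ ?_ (pi_bdd hθ) ?_ f
  · filter_upwards [eventually_ge_atTop 1] with n hn
    have := nu_prob hθ hn
    exact Measure.isProbabilityMeasure_map (marginal_map_meas n p).aemeasurable
  · intro K
    filter_upwards [eventually_ge_atTop p] with n hn
    exact marg_integrable hθ hp hn K.1 K.2
  · intro K
    exact moment_lim hθ hp K.1 K.2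
end P9


/-- The marginals `ν_n⁽ᵖ⁾` of the eigenvalue distributions converge, both weakly and in
`*`-moments, to the `p`-fold product of the uniform distribution on the solid ellipse. -/
theorem stmt4 (θ : ℝ) (hθ : θ ∈ Set.Ioo 0 (π / 2)) (p : ℕ) (hp : 1 ≤ p) :
    (∀ n : ℕ, 1 ≤ n → Integrable (thetaDensity θ n) ∧
        0 < ∫ d : Fin n → ℂ, thetaDensity θ n d) ∧
    (∀ f : BoundedContinuousFunction (Fin p → ℂ) ℝ,
      Tendsto (fun n : ℕ => ∫ x, f x ∂(marginal n p (nuTheta θ n))) atTop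
        (nhds (∫ x, f x ∂(Measure.pi fun _ : Fin p => ellipseUniform θ)))) ∧
    (∀ kk ll : Fin p → ℕ,
      Tendsto (fun n : ℕ =>
          ∫ z, (∏ i, (z i) ^ kk i * (starRingEnd ℂ (z i)) ^ ll i)
            ∂(marginal n p (nuTheta θ n))) atTop
        (nhds (∫ z, (∏ i, (z i) ^ kk i * (starRingEnd ℂ (z i)) ^ ll i)
            ∂(Measure.pi fun _ : Fin p => ellipseUniform θ)))) := by
  exact ⟨fun n hn => ⟨theta_integrable hθ hn, theta_int_pos hθ hn⟩,
    fun f => weak_lim hθ hp f, fun kk ll => moment_lim hθ hp kk ll⟩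
end
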